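/- Let (L,Δ,S) and (L',Δ',S') be localities with products Π : D → L and Π' : D' → L', and let β : L → L' be a homomorphism of partial groups. Let (L_0,Δ_0,S_0) be a sublocality of (L,Δ,S) with S_0β ⊆ S' and (D ∩ W(L_0))β* = D' ∩ W(L_0β). Then (L_0β, Δ_0β, S_0β) is a sublocality of (L',Δ',S'), and β|_{L_0} : L_0 → L_0β is a projection of localities from (L_0,Δ_0,S_0) to (L_0β,Δ_0β,S_0β). -/

import Mathlib

/-!
Background definitions for partial groups and localities in the sense of Chermak.

A *partial group* is given by `Data`: a domain `D` of words, a (total, but only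
meaningful on `D`) product `pi : List L → L`, and an inversion map, subject to the
axioms collected in `IsPartialGroup`.
-/

namespace PartialGroups

/-- The underlying data of a partial group. -/
structure Data (L : Type*) where
  /-- The domain of the product, a set of words. -/
  D : Set (List L)
  /-- The product `Π`, meaningful on `D`. -/
  pi : List L → L
  /-- The inversion map. -/
  inv : L → L

variable {L L' L₁ L₂ L₁' L₂' : Type*}

/-- The formal inverse of a word: `(f₁,…,fₙ)⁻¹ = (fₙ⁻¹,…,f₁⁻¹)`. -/
def Data.wInv (P : Data L) (w : List L) : List L := (w.map P.inv).reverse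

/-- The identity element `1 = Π(∅)`. -/
def Data.one (P : Data L) : L := P.pi []

/-- The axioms of a partial group. -/
structure IsPartialGroup (P : Data L) : Prop where
  /-- Inversion is an involution (in particular a bijection). -/
  inv_inv : ∀ f : L, P.inv (P.inv f) = f
  /-- `L ⊆ D` (words of length one lie in the domain). -/
  singleton_mem : ∀ f : L, [f] ∈ P.D
  /-- `u ∘ v ∈ D` implies `u ∈ D`. -/
  append_left : ∀ u v : List L, u ++ v ∈ P.D → u ∈ P.D
  /-- `u ∘ v ∈ D` implies `v ∈ D`. -/
  append_right : ∀ u v : List L, u ++ v ∈ P.D → v ∈ P.D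
  /-- `Π` restricts to the identity on words of length one. -/
  pi_singleton : ∀ f : L, P.pi [f] = f
  /-- `u ∘ v ∘ w ∈ D` implies `u ∘ (Π(v)) ∘ w ∈ D`. -/
  assoc_mem : ∀ u v w : List L, u ++ v ++ w ∈ P.D → u ++ [P.pi v] ++ w ∈ P.D
  /-- `Π(u ∘ v ∘ w) = Π(u ∘ (Π(v)) ∘ w)`. -/
  assoc_pi : ∀ u v w : List L, u ++ v ++ w ∈ P.D →
    P.pi (u ++ v ++ w) = P.pi (u ++ [P.pi v] ++ w)
  /-- `w ∈ D` implies `w⁻¹ ∘ w ∈ D`. -/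
  wInv_mem : ∀ w ∈ P.D, P.wInv w ++ w ∈ P.D
  /-- `Π(w⁻¹ ∘ w) = 1`. -/
  wInv_pi : ∀ w ∈ P.D, P.pi (P.wInv w ++ w) = P.one

/-- `D(g)`: the set of `x` for which `x^g` is defined. -/
def Data.Dconj (P : Data L) (g : L) : Set L := {x | [P.inv g, x, g] ∈ P.D}

/-- Conjugation `x^g = Π(g⁻¹, x, g)`. -/
def Data.conj (P : Data L) (x g : L) : L := P.pi [P.inv g, x, g]

/-- `X^g = {x^g : x ∈ X}`. -/
def Data.conjSet (P : Data L) (X : Set L) (g : L) : Set L := (fun x => P.conj x g) '' X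

/-- `W(H)`: the set of words with all entries in `H`. -/
def Wrd (H : Set L) : Set (List L) := {w | ∀ x ∈ w, x ∈ H}

/-- The centralizer `C_L(X) = {g : x ∈ D(g) and x^g = x for all x ∈ X}`. -/
def Data.centralizer (P : Data L) (X : Set L) : Set L :=
  {g | ∀ x ∈ X, x ∈ P.Dconj g ∧ P.conj x g = x}

/-- The center `Z(L) = C_L(L)`. -/
def Data.center (P : Data L) : Set L := P.centralizer Set.univ

/-- The normalizer `N_L(X) = {g : X ⊆ D(g) and X^g = X}`. -/
def Data.normalizer (P : Data L) (X : Set L) : Set L :=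
  {g | X ⊆ P.Dconj g ∧ P.conjSet X g = X}

/-- The centralizer of `X` computed inside the partial subgroup `L₀`. -/
def Data.centralizerIn (P : Data L) (L₀ X : Set L) : Set L := L₀ ∩ P.centralizer X

/-- The center of the partial subgroup `L₀` (with its restricted partial product). -/
def Data.centerIn (P : Data L) (L₀ : Set L) : Set L := P.centralizerIn L₀ L₀

/-- The set product `XY = {Π(x,y) : x ∈ X, y ∈ Y, (x,y) ∈ D}`. -/
def Data.setMul (P : Data L) (X Y : Set L) : Set L :=
  {z | ∃ x ∈ X, ∃ y ∈ Y, [x, y] ∈ P.D ∧ P.pi [x, y] = z}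

/-- `S_g = {s ∈ S ∩ D(g) : s^g ∈ S}`. -/
def Data.SOf (P : Data L) (S : Set L) (g : L) : Set L :=
  {s | s ∈ S ∧ s ∈ P.Dconj g ∧ P.conj s g ∈ S}

/-- A partial subgroup: closed under inversion and under products of words in the domain. -/
def Data.IsPartialSubgroup (P : Data L) (H : Set L) : Prop :=
  (∀ f ∈ H, P.inv f ∈ H) ∧ ∀ w ∈ Wrd H ∩ P.D, P.pi w ∈ H

/-- A subgroup: a partial subgroup `H` with `W(H) ⊆ D`. -/
def Data.IsSubgroup (P : Data L) (H : Set L) : Prop :=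
  P.IsPartialSubgroup H ∧ Wrd H ⊆ P.D

/-- A `p`-subgroup: a subgroup whose order is a power of `p`. -/
def Data.IsPSubgroup (p : ℕ) (P : Data L) (H : Set L) : Prop :=
  P.IsSubgroup H ∧ ∃ n : ℕ, H.ncard = p ^ n

/-- A partial normal subgroup: `n^f ∈ N` for all `f ∈ L` and `n ∈ N ∩ D(f)`. -/
def Data.IsPartialNormal (P : Data L) (N : Set L) : Prop :=
  P.IsPartialSubgroup N ∧ ∀ f : L, ∀ n ∈ N, n ∈ P.Dconj f → P.conj n f ∈ N

/-- A homomorphism of partial groups: `Dβ* ⊆ D'` and `Π'(vβ*) = (Π(v))β`. -/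
def IsHom (P : Data L) (P' : Data L') (β : L → L') : Prop :=
  (∀ w ∈ P.D, w.map β ∈ P'.D) ∧ ∀ w ∈ P.D, P'.pi (w.map β) = β (P.pi w)

/-- A projection of partial groups: a homomorphism with `Dβ* = D'`. -/
def IsProjection (P : Data L) (P' : Data L') (β : L → L') : Prop :=
  IsHom P P' β ∧ ∀ w' ∈ P'.D, ∃ w ∈ P.D, w.map β = w'

/-- An isomorphism of partial groups: an injective projection. -/
def IsIsomorphism (P : Data L) (P' : Data L') (β : L → L') : Prop :=
  IsProjection P P' β ∧ Function.Injective β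

/-- The kernel `ker(β) = {f : fβ = 1'}`. -/
def pgKer (P : Data L) (P' : Data L') (β : L → L') : Set L := {f | β f = P'.one}

/-- `β` restricted to the partial subgroup `L₀` is a homomorphism of partial groups
(the source being `L₀` with the restricted product). -/
def IsHomBetween (P : Data L) (P' : Data L') (L₀ : Set L) (β : L → L') : Prop :=
  (∀ w ∈ P.D ∩ Wrd L₀, w.map β ∈ P'.D) ∧
    ∀ w ∈ P.D ∩ Wrd L₀, P'.pi (w.map β) = β (P.pi w)

/-- `β` restricted to a map `L₀ → L₀'` is a projection of partial groups between
the restricted partial groups on `L₀` and `L₀'` (so `(D ∩ W(L₀))β* = D' ∩ W(L₀')`). -/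
def IsProjBetween (P : Data L) (P' : Data L') (L₀ : Set L) (L₀' : Set L') (β : L → L') :
    Prop :=
  β '' L₀ = L₀' ∧ IsHomBetween P P' L₀ β ∧
    ∀ w' ∈ P'.D ∩ Wrd L₀', ∃ w ∈ P.D ∩ Wrd L₀, w.map β = w'

/-- `β` restricted to a map `L₀ → L₀'` is an isomorphism of partial groups. -/
def IsIsoBetween (P : Data L) (P' : Data L') (L₀ : Set L) (L₀' : Set L') (β : L → L') :
    Prop :=
  IsProjBetween P P' L₀ L₀' β ∧ Set.InjOn β L₀

/-- `chainFrom P Δ w Q` means: the word `w` lies in `D_Δ` via the chain starting at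
`P₀ = Q`, i.e. there are `P₀,…,Pₙ ∈ Δ` with `P_{i-1} ⊆ D(f_i)` and `P_{i-1}^{f_i} = P_i`. -/
def chainFrom (P : Data L) (Δ : Set (Set L)) : List L → Set L → Prop
  | [], _ => True
  | f :: w, Q => Q ⊆ P.Dconj f ∧ P.conjSet Q f ∈ Δ ∧ chainFrom P Δ w (P.conjSet Q f)

/-- The set of words `D_Δ`. -/
def DDelta (P : Data L) (Δ : Set (Set L)) : Set (List L) :=
  {w | ∃ Q ∈ Δ, chainFrom P Δ w Q}

/-- `(L,Δ,S)` is a locality (for the prime `p`). -/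
structure IsLocality (p : ℕ) (P : Data L) (Δ : Set (Set L)) (S : Set L) : Prop where
  isPartialGroup : IsPartialGroup P
  /-- `L` is finite as a set. -/
  finite : Finite L
  /-- `S` is a `p`-subgroup of `L`. -/
  pSubgroup : P.IsPSubgroup p S
  /-- `Δ` is nonempty. -/
  delta_nonempty : Δ.Nonempty
  /-- `Δ` is a set of subgroups of `S`. -/
  delta_subgroups : ∀ Q ∈ Δ, P.IsSubgroup Q ∧ Q ⊆ S
  /-- (L1): `S` is maximal among the `p`-subgroups of `L`. -/
  s_maximal : ∀ T : Set L, P.IsPSubgroup p T → S ⊆ T → T = S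
  /-- (L2): `D = D_Δ`. -/
  d_eq : P.D = DDelta P Δ
  /-- (L3): overgroups in `S` of conjugates of members of `Δ` lie in `Δ`. -/
  delta_closed : ∀ Q : Set L, P.IsSubgroup Q → Q ⊆ S →
    (∃ R ∈ Δ, ∃ g : L, R ⊆ P.Dconj g ∧ P.conjSet R g ⊆ Q) → Q ∈ Δ

/-- `(L₀,Δ,S)` is a locality, where `L₀` is a partial subgroup of the ambient partial
group and `L₀` is regarded as a partial group with the restricted product.  All the
conditions are expressed via the ambient product (with which the restricted one
agrees on words in `W(L₀)`). -/
structure IsLocalityIn (p : ℕ) (P : Data L) (L₀ : Set L) (Δ : Set (Set L)) (S : Set L) :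
    Prop where
  partialSubgroup : P.IsPartialSubgroup L₀
  /-- `L₀` is finite as a set. -/
  finite : L₀.Finite
  /-- `S` is a `p`-subgroup. -/
  pSubgroup : P.IsPSubgroup p S
  s_sub : S ⊆ L₀
  delta_nonempty : Δ.Nonempty
  delta_subgroups : ∀ Q ∈ Δ, P.IsSubgroup Q ∧ Q ⊆ S
  /-- (L1) for the restriction. -/
  s_maximal : ∀ T : Set L, T ⊆ L₀ → P.IsPSubgroup p T → S ⊆ T → T = S
  /-- (L2) for the restriction. -/
  d_eq : ∀ w ∈ Wrd L₀, (w ∈ P.D ↔ w ∈ DDelta P Δ)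
  /-- (L3) for the restriction. -/
  delta_closed : ∀ Q : Set L, P.IsSubgroup Q → Q ⊆ S →
    (∃ R ∈ Δ, ∃ g ∈ L₀, R ⊆ P.Dconj g ∧ P.conjSet R g ⊆ Q) → Q ∈ Δ

/-- `(L₀,Δ₀,S₀)` is a sublocality of a locality with Sylow subgroup `S`. -/
def IsSubLocality (p : ℕ) (P : Data L) (S : Set L) (L₀ : Set L) (Δ₀ : Set (Set L))
    (S₀ : Set L) : Prop :=
  S₀ = S ∩ L₀ ∧ IsLocalityIn p P L₀ Δ₀ S₀

/-- A projection of localities: a projection of partial groups with `Δβ = Δ'`. -/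
def IsLocalityProj (P : Data L) (P' : Data L') (Δ : Set (Set L)) (Δ' : Set (Set L'))
    (β : L → L') : Prop :=
  IsProjection P P' β ∧ Set.image β '' Δ = Δ'

/-- `β` restricted to `L₀ → L₀'` is a projection of localities. -/
def IsLocalityProjBetween (P : Data L) (P' : Data L') (L₀ : Set L) (Δ₀ : Set (Set L))
    (L₀' : Set L') (Δ₀' : Set (Set L')) (β : L → L') : Prop :=
  IsProjBetween P P' L₀ L₀' β ∧ Set.image β '' Δ₀ = Δ₀'

/-- The right coset `Nf = {Π(n,f) : n ∈ N, (n,f) ∈ D}`. -/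
def rightCoset (P : Data L) (N : Set L) (f : L) : Set L :=
  {y | ∃ n ∈ N, [n, f] ∈ P.D ∧ P.pi [n, f] = y}

/-- The data of the external direct product of two partial groups:  the domain consists
of the words whose words of first resp. second coordinates lie in the respective domains,
and the product and the inversion are computed coordinatewise. -/
def prodData (P₁ : Data L₁) (P₂ : Data L₂) : Data (L₁ × L₂) where
  D := {u | u.map Prod.fst ∈ P₁.D ∧ u.map Prod.snd ∈ P₂.D}
  pi := fun u => (P₁.pi (u.map Prod.fst), P₂.pi (u.map Prod.snd))
  inv := fun f => (P₁.inv f.1, P₂.inv f.2)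

/-- `Δ₁ * Δ₂`: the set of subgroups of `S₁ × S₂` containing some `P₁ × P₂` with
`P_i ∈ Δ_i`. -/
def deltaStar (P₁ : Data L₁) (P₂ : Data L₂) (Δ₁ : Set (Set L₁)) (Δ₂ : Set (Set L₂))
    (S₁ : Set L₁) (S₂ : Set L₂) : Set (Set (L₁ × L₂)) :=
  {Q | (prodData P₁ P₂).IsSubgroup Q ∧ Q ⊆ S₁ ×ˢ S₂ ∧
    ∃ R₁ ∈ Δ₁, ∃ R₂ ∈ Δ₂, R₁ ×ˢ R₂ ⊆ Q}

/-- `K` is a normal `p`-subgroup of the subgroup `M` of the ambient partial group. -/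
def Data.IsNormalPSubgroupIn (p : ℕ) (P : Data L) (M K : Set L) : Prop :=
  K ⊆ M ∧ P.IsSubgroup K ∧ (∃ n : ℕ, K.ncard = p ^ n) ∧
    ∀ f ∈ M, ∀ x ∈ K, x ∈ P.Dconj f ∧ P.conj x f ∈ K

/-- `O_p(M)`: the largest normal `p`-subgroup of the subgroup `M` (the union of all
normal `p`-subgroups of `M`). -/
def Data.pCoreIn (p : ℕ) (P : Data L) (M : Set L) : Set L :=
  ⋃₀ {K | P.IsNormalPSubgroupIn p M K}

/-- The subgroup `M` of the ambient partial group is of characteristic `p`: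
`C_M(O_p(M)) ≤ O_p(M)`. -/
def Data.IsCharPSubgroup (p : ℕ) (P : Data L) (M : Set L) : Prop :=
  P.centralizerIn M (P.pCoreIn p M) ⊆ P.pCoreIn p M

/-- A locality is of objective characteristic `p` if `N_L(Q)` is of characteristic `p`
for every `Q ∈ Δ`. -/
def IsObjectiveCharP (p : ℕ) (P : Data L) (Δ : Set (Set L)) : Prop :=
  ∀ Q ∈ Δ, P.IsCharPSubgroup p (P.normalizer Q)

/-- The word `(Π(f₁,g₁),…,Π(fₙ,gₙ))` built from the words `u = (f₁,…,fₙ)` and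
`v = (g₁,…,gₙ)`. -/
def zipProd (P : Data L) (u v : List L) : List L :=
  List.zipWith (fun f g => P.pi [f, g]) u v

/-- `L` is the internal central product of `M₁` and `M₂`: conditions (C1) and (C2). -/
def IsInternalCentralProduct (P : Data L) (M₁ M₂ : Set L) : Prop :=
  (P.D = {w | ∃ u v : List L, u ∈ P.D ∩ Wrd M₁ ∧ v ∈ P.D ∩ Wrd M₂ ∧
      u.length = v.length ∧ (∀ q ∈ u.zip v, [q.1, q.2] ∈ P.D) ∧ w = zipProd P u v}) ∧
  ∀ u v : List L, u ∈ P.D ∩ Wrd M₁ → v ∈ P.D ∩ Wrd M₂ → u.length = v.length →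
    (∀ q ∈ u.zip v, [q.1, q.2] ∈ P.D) →
    P.pi (zipProd P u v) = P.pi [P.pi u, P.pi v]

/-- `L` is the internal direct product of `M₁` and `M₂`: (C1), (C2) and (D). -/
def IsInternalDirectProduct (P : Data L) (M₁ M₂ : Set L) : Prop :=
  IsInternalCentralProduct P M₁ M₂ ∧
    ∀ h : L, ∃! fg : L × L, fg.1 ∈ M₁ ∧ fg.2 ∈ M₂ ∧ [fg.1, fg.2] ∈ P.D ∧
      P.pi [fg.1, fg.2] = h

theorem Data.mem_Dconj {P : Data L} {x g : L} : x ∈ P.Dconj g ↔ [P.inv g, x, g] ∈ P.D := Iff.rfl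

namespace IsPartialGroup

variable {P : Data L} {P' : Data L'} {β : L → L'}

theorem mem_of_append (h : IsPartialGroup P) {u v w : List L} (hw : u ++ v ++ w ∈ P.D) : v ∈ P.D :=
  h.append_right u v (h.append_left _ _ hw)

theorem nil_mem (h : IsPartialGroup P) : [] ∈ P.D :=
  h.append_left [] [P.one] (h.singleton_mem _)

theorem wInv_wInv (h : IsPartialGroup P) (w : List L) : P.wInv (P.wInv w) = w := by
  simp only [Data.wInv, List.map_reverse, List.reverse_reverse, List.map_map]
  conv_rhs => rw [← List.map_id w]
  exact List.map_congr_left fun a _ => h.inv_inv a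

theorem mem_wInv (h : IsPartialGroup P) {w : List L} (hw : w ∈ P.D) : P.wInv w ∈ P.D :=
  h.append_left _ _ (h.wInv_mem w hw)

theorem append_wInv_mem (h : IsPartialGroup P) {w : List L} (hw : w ∈ P.D) :
    w ++ P.wInv w ∈ P.D := by
  simpa only [h.wInv_wInv] using h.wInv_mem _ (h.mem_wInv hw)

theorem append_wInv_pi (h : IsPartialGroup P) {w : List L} (hw : w ∈ P.D) :
    P.pi (w ++ P.wInv w) = P.one := by
  simpa only [h.wInv_wInv] using h.wInv_pi _ (h.mem_wInv hw)

theorem inv_mul (h : IsPartialGroup P) (f : L) : P.pi [P.inv f, f] = P.one :=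
  h.wInv_pi [f] (h.singleton_mem f)

theorem mul_inv (h : IsPartialGroup P) (f : L) : P.pi [f, P.inv f] = P.one :=
  h.append_wInv_pi (h.singleton_mem f)

theorem one_mul_mem (h : IsPartialGroup P) (f : L) : [P.one, f] ∈ P.D :=
  h.assoc_mem [] [] [f] (h.singleton_mem f)

theorem one_mul (h : IsPartialGroup P) (f : L) : P.pi [P.one, f] = f := by
  have := h.assoc_pi [] [] [f] (h.singleton_mem f)
  exact this.symm.trans (h.pi_singleton f)

theorem mul_one (h : IsPartialGroup P) (f : L) : P.pi [f, P.one] = f := by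
  have := h.assoc_pi [f] [] [] (h.singleton_mem f)
  exact this.symm.trans (h.pi_singleton f)

theorem pi_append_mem (h : IsPartialGroup P) {u v : List L} (huv : u ++ v ∈ P.D) :
    [P.pi u, P.pi v] ∈ P.D := by
  have h1 := h.assoc_mem [] u v huv
  simpa using h.assoc_mem [P.pi u] v [] (by simpa using h1)

theorem pi_append (h : IsPartialGroup P) {u v : List L} (huv : u ++ v ∈ P.D) :
    P.pi (u ++ v) = P.pi [P.pi u, P.pi v] := by
  have h1 := h.assoc_mem [] u v huv
  have h2 := h.assoc_pi [] u v huv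
  have h3 := h.assoc_pi [P.pi u] v [] (by simpa using h1)
  simp only [List.nil_append, List.append_nil, List.singleton_append] at h2 h3
  rw [h2, h3]

theorem eq_inv_of_pi_eq_one (h : IsPartialGroup P) {a b : L} (hab : [a, b] ∈ P.D)
    (h1 : P.pi [a, b] = P.one) : a = P.inv b := by
  have h4 : [a, b, P.inv b] ++ [P.inv a] ∈ P.D := h.append_wInv_mem hab
  have h3 : [a, b, P.inv b] ∈ P.D := h.append_left _ _ h4
  have e1 := h.assoc_pi [] [a, b] [P.inv b] h3
  have e2 := h.assoc_pi [a] [b, P.inv b] [] h3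
  simp only [List.nil_append, List.append_nil, List.cons_append, h1,
    h.mul_inv, h.one_mul, h.mul_one] at e1 e2
  rw [← e1, e2]

theorem inv_pi (h : IsPartialGroup P) {w : List L} (hw : w ∈ P.D) :
    P.inv (P.pi w) = P.pi (P.wInv w) := by
  have h1 := h.wInv_mem w hw
  refine (h.eq_inv_of_pi_eq_one (h.pi_append_mem h1) ?_).symm
  rw [← h.pi_append h1, h.wInv_pi w hw]

theorem inv_one (h : IsPartialGroup P) : P.inv P.one = P.one := h.inv_pi h.nil_mem

theorem mem_Dconj_one (h : IsPartialGroup P) (x : L) : x ∈ P.Dconj P.one := by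
  have := h.assoc_mem [P.one, x] [] [] (by simpa using h.one_mul_mem x)
  rw [Data.mem_Dconj, h.inv_one]
  exact this

theorem conj_one (h : IsPartialGroup P) (x : L) : P.conj x P.one = x := by
  have := h.assoc_pi [P.one, x] [] [] (by simpa using h.one_mul_mem x)
  simp only [List.append_nil, h.one_mul] at this
  rw [Data.conj, h.inv_one]
  exact this.symm

theorem one_conj (h : IsPartialGroup P) (g : L) : P.conj P.one g = P.one := by
  have := h.assoc_pi [P.inv g] [] [g] (h.wInv_mem [g] (h.singleton_mem g))
  exact this.symm.trans (h.inv_mul g)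

theorem inv_mem_Dconj (h : IsPartialGroup P) {x g : L} (hx : x ∈ P.Dconj g) :
    P.inv x ∈ P.Dconj g := by
  have := h.mem_wInv hx
  simpa [Data.Dconj, Data.wInv, h.inv_inv] using this

theorem conj_inv (h : IsPartialGroup P) {x g : L} (hx : x ∈ P.Dconj g) :
    P.conj (P.inv x) g = P.inv (P.conj x g) := by
  rw [Data.conj, Data.conj, h.inv_pi hx]
  simp [Data.wInv, h.inv_inv]

theorem mem_conj_word (h : IsPartialGroup P) {x g : L} (hx : x ∈ P.Dconj g) :
    [g, P.inv g, x, g, P.inv g] ∈ P.D := by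
  have h1 : [P.inv g, P.inv x, g] ∈ P.D := h.inv_mem_Dconj hx
  have h2 := h.append_wInv_mem (h.append_wInv_mem h1)
  simp only [Data.wInv, List.map_cons, List.map_nil, List.reverse_cons, List.reverse_nil,
    List.nil_append, List.cons_append, h.inv_inv] at h2
  exact h.mem_of_append (u := [P.inv g, P.inv x]) (v := [g, P.inv g, x, g, P.inv g]) h2

theorem conj_mem_Dconj_inv (h : IsPartialGroup P) {x g : L} (hx : x ∈ P.Dconj g) :
    P.conj x g ∈ P.Dconj (P.inv g) := by
  have := h.assoc_mem [g] [P.inv g, x, g] [P.inv g] (h.mem_conj_word hx)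
  rw [Data.mem_Dconj, h.inv_inv]
  exact this

theorem conj_conj_inv (h : IsPartialGroup P) {x g : L} (hx : x ∈ P.Dconj g) :
    P.conj (P.conj x g) (P.inv g) = x := by
  have hw := h.mem_conj_word hx
  have e1 := h.assoc_pi [g] [P.inv g, x, g] [P.inv g] hw
  have e2 := h.assoc_pi [] [g, P.inv g] [x, g, P.inv g] hw
  have m2 := h.assoc_mem [] [g, P.inv g] [x, g, P.inv g] hw
  simp only [h.mul_inv, List.nil_append, List.cons_append] at e1 e2 m2
  have m3 : [P.one, x] ∈ P.D := h.one_mul_mem x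
  have e3 := h.assoc_pi [P.one, x] [g, P.inv g] [] m2
  have e4 := h.assoc_pi [P.one, x] [] [] m3
  simp only [h.mul_inv, List.append_nil, List.cons_append, List.nil_append, h.one_mul] at e3 e4
  rw [Data.conj, h.inv_inv]
  exact e1.symm.trans (e2.trans (e3.trans e4.symm))

theorem conj_injOn (h : IsPartialGroup P) (g : L) : Set.InjOn (fun x => P.conj x g) (P.Dconj g) := by
  intro x hx y hy hxy
  rw [← h.conj_conj_inv hx, ← h.conj_conj_inv hy]
  exact congrArg (fun z => P.conj z (P.inv g)) hxy

theorem mul_mem_Dconj (h : IsPartialGroup P) {x y g : L}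
    (hw : [P.inv g, x, g, P.inv g, y, g] ∈ P.D) : P.pi [x, y] ∈ P.Dconj g := by
  have m1 := h.assoc_mem [P.inv g, x] [g, P.inv g] [y, g] hw
  simp only [h.mul_inv, List.cons_append, List.nil_append] at m1
  have m2 := h.assoc_mem [P.inv g] [x, P.one] [y, g] m1
  simp only [h.mul_one, List.cons_append, List.nil_append] at m2
  exact h.assoc_mem [P.inv g] [x, y] [g] m2

theorem conj_mul (h : IsPartialGroup P) {x y g : L}
    (hw : [P.inv g, x, g, P.inv g, y, g] ∈ P.D) :
    P.conj (P.pi [x, y]) g = P.pi [P.conj x g, P.conj y g] := by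
  have m1 := h.assoc_mem [P.inv g, x] [g, P.inv g] [y, g] hw
  have e1 := h.assoc_pi [P.inv g, x] [g, P.inv g] [y, g] hw
  simp only [h.mul_inv, List.cons_append, List.nil_append] at m1 e1
  have m2 := h.assoc_mem [P.inv g] [x, P.one] [y, g] m1
  have e2 := h.assoc_pi [P.inv g] [x, P.one] [y, g] m1
  simp only [h.mul_one, List.cons_append, List.nil_append] at m2 e2
  have e3 := h.assoc_pi [P.inv g] [x, y] [g] m2
  have e4 := h.pi_append (u := [P.inv g, x, g]) (v := [P.inv g, y, g]) hw
  exact e3.symm.trans (e2.symm.trans (e1.symm.trans e4))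

theorem inv_mul_rev (h : IsPartialGroup P) {a b : L} (hab : [a, b] ∈ P.D) :
    P.inv (P.pi [a, b]) = P.pi [P.inv b, P.inv a] := h.inv_pi hab

theorem mem_Dconj_mul (h : IsPartialGroup P) {x a b : L}
    (hw : [P.inv b, P.inv a, x, a, b] ∈ P.D) : x ∈ P.Dconj (P.pi [a, b]) := by
  have hab : [a, b] ∈ P.D := h.append_right [P.inv b, P.inv a, x] _ hw
  have m1 := h.assoc_mem [P.inv b, P.inv a, x] [a, b] [] hw
  have m2 := h.assoc_mem [] [P.inv b, P.inv a] [x, P.pi [a, b]] m1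
  simpa [Data.Dconj, h.inv_mul_rev hab] using m2

theorem conj_conj (h : IsPartialGroup P) {x a b : L}
    (hw : [P.inv b, P.inv a, x, a, b] ∈ P.D) :
    P.conj x (P.pi [a, b]) = P.conj (P.conj x a) b := by
  have hab : [a, b] ∈ P.D := h.append_right [P.inv b, P.inv a, x] _ hw
  have m1 := h.assoc_mem [P.inv b, P.inv a, x] [a, b] [] hw
  have e1 := h.assoc_pi [P.inv b, P.inv a, x] [a, b] [] hw
  have e2 := h.assoc_pi [] [P.inv b, P.inv a] [x, P.pi [a, b]] m1
  have e3 := h.assoc_pi [P.inv b] [P.inv a, x, a] [b] hw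
  rw [Data.conj, h.inv_mul_rev hab]
  exact e2.symm.trans (e1.symm.trans e3)

theorem inv_mul_mul_conj (h : IsPartialGroup P) {x g : L} (hx : x ∈ P.Dconj g) :
    P.pi [P.inv x, g, P.conj x g] = g := by
  have h1 := h.wInv_mem _ hx
  simp only [Data.wInv, List.map_cons, List.map_nil, List.reverse_cons, List.reverse_nil,
    List.nil_append, List.cons_append, h.inv_inv] at h1
  have hw : [P.inv x, g, P.inv g, x, g] ∈ P.D := h.append_right [P.inv g] _ h1
  have e1 := h.assoc_pi [P.inv x, g] [P.inv g, x, g] [] hw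
  have m2 := h.assoc_mem [P.inv x] [g, P.inv g] [x, g] hw
  have e2 := h.assoc_pi [P.inv x] [g, P.inv g] [x, g] hw
  simp only [h.mul_inv, List.append_nil, List.cons_append, List.nil_append] at e1 e2 m2
  have m3 := h.assoc_mem [] [P.inv x, P.one] [x, g] m2
  have e3 := h.assoc_pi [] [P.inv x, P.one] [x, g] m2
  simp only [h.mul_one, List.cons_append, List.nil_append] at m3 e3
  have e4 := h.assoc_pi [] [P.inv x, x] [g] m3
  simp only [h.inv_mul, h.one_mul, List.cons_append, List.nil_append] at e4
  exact e1.symm.trans (e2.trans (e3.trans e4))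

theorem mul_mul_inv (h : IsPartialGroup P) {a b : L} (hab : [a, b] ∈ P.D) :
    P.pi [P.pi [a, b], P.inv b] = a := by
  have hw : [a, b, P.inv b] ∈ P.D := h.append_left _ [P.inv a] (h.append_wInv_mem hab)
  have e1 := h.assoc_pi [] [a, b] [P.inv b] hw
  have e2 := h.assoc_pi [a] [b, P.inv b] [] hw
  simp only [h.mul_inv, h.mul_one, List.append_nil, List.cons_append, List.nil_append] at e1 e2
  exact e1.symm.trans e2

end IsPartialGroup

namespace IsHom

variable {P : Data L} {P' : Data L'} {β : L → L'}

theorem map_one (hβ : IsHom P P' β) (h : IsPartialGroup P) : β P.one = P'.one :=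
  (hβ.2 [] h.nil_mem).symm

theorem map_mul (hβ : IsHom P P' β) {a b : L} (hab : [a, b] ∈ P.D) :
    β (P.pi [a, b]) = P'.pi [β a, β b] := (hβ.2 _ hab).symm

theorem map_inv (hβ : IsHom P P' β) (h : IsPartialGroup P) (h' : IsPartialGroup P') (f : L) :
    β (P.inv f) = P'.inv (β f) := by
  have hf : [P.inv f, f] ∈ P.D := h.wInv_mem [f] (h.singleton_mem f)
  refine h'.eq_inv_of_pi_eq_one (hβ.1 _ hf) ?_
  rw [← hβ.map_mul hf, h.inv_mul, hβ.map_one h]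

theorem map_mem_Dconj (hβ : IsHom P P' β) (h : IsPartialGroup P) (h' : IsPartialGroup P')
    {x g : L} (hx : x ∈ P.Dconj g) : β x ∈ P'.Dconj (β g) := by
  have := hβ.1 _ hx
  simpa [Data.Dconj, hβ.map_inv h h'] using this

theorem map_conj (hβ : IsHom P P' β) (h : IsPartialGroup P) (h' : IsPartialGroup P')
    {x g : L} (hx : x ∈ P.Dconj g) : β (P.conj x g) = P'.conj (β x) (β g) := by
  have := hβ.2 _ hx
  simpa [Data.conj, hβ.map_inv h h'] using this.symm

theorem image_conjSet (hβ : IsHom P P' β) (h : IsPartialGroup P) (h' : IsPartialGroup P')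
    {X : Set L} {g : L} (hX : X ⊆ P.Dconj g) :
    β '' P.conjSet X g = P'.conjSet (β '' X) (β g) := by
  rw [Data.conjSet, Data.conjSet, Set.image_image, Set.image_image]
  exact Set.image_congr fun x hx => hβ.map_conj h h' (hX hx)

end IsHom

namespace Data.IsSubgroup

variable {P : Data L} {H K : Set L}

theorem mem (hH : P.IsSubgroup H) {w : List L} (hw : ∀ x ∈ w, x ∈ H) : w ∈ P.D := hH.2 hw

theorem pi_mem (hH : P.IsSubgroup H) {w : List L} (hw : ∀ x ∈ w, x ∈ H) : P.pi w ∈ H :=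
  hH.1.2 w ⟨hw, hH.2 hw⟩

theorem one_mem (hH : P.IsSubgroup H) : P.one ∈ H := hH.pi_mem (w := []) (by simp)

theorem inv_mem (hH : P.IsSubgroup H) {x : L} (hx : x ∈ H) : P.inv x ∈ H := hH.1.1 x hx

theorem mul_mem (hH : P.IsSubgroup H) {x y : L} (hx : x ∈ H) (hy : y ∈ H) : P.pi [x, y] ∈ H :=
  hH.pi_mem (by simp [hx, hy])

theorem mem_Dconj (hH : P.IsSubgroup H) {x g : L} (hx : x ∈ H) (hg : g ∈ H) : x ∈ P.Dconj g :=
  hH.mem (by simp [hx, hg, hH.inv_mem hg])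

theorem conj_mem (hH : P.IsSubgroup H) {x g : L} (hx : x ∈ H) (hg : g ∈ H) : P.conj x g ∈ H :=
  hH.pi_mem (by simp [hx, hg, hH.inv_mem hg])

theorem of_words (h : IsPartialGroup P) (hD : Wrd K ⊆ P.D) (h1 : P.one ∈ K)
    (hinv : ∀ x ∈ K, P.inv x ∈ K) (hmul : ∀ x ∈ K, ∀ y ∈ K, P.pi [x, y] ∈ K) :
    P.IsSubgroup K := by
  refine ⟨⟨hinv, fun w hw => ?_⟩, hD⟩
  obtain ⟨hw, -⟩ := hw
  induction w with
  | nil => exact h1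
  | cons a w ih =>
    have hw' := List.forall_mem_cons.1 hw
    have := h.pi_append (u := [a]) (v := w) (hD hw)
    rw [h.pi_singleton, List.singleton_append] at this
    rw [this]
    exact hmul _ hw'.1 _ (ih hw'.2)

/-- A subset of a subgroup which is closed under binary products and inversion is a subgroup. -/
theorem of_subset (h : IsPartialGroup P) (hH : P.IsSubgroup H) (hKH : K ⊆ H) (h1 : P.one ∈ K)
    (hinv : ∀ x ∈ K, P.inv x ∈ K) (hmul : ∀ x ∈ K, ∀ y ∈ K, P.pi [x, y] ∈ K) :
    P.IsSubgroup K :=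
  of_words h (fun _ hw => hH.mem fun x hx => hKH (hw x hx)) h1 hinv hmul

theorem inter (hH : P.IsSubgroup H) (hK : P.IsPartialSubgroup K) : P.IsSubgroup (H ∩ K) :=
  ⟨⟨fun f hf => ⟨hH.inv_mem hf.1, hK.1 f hf.2⟩, fun w hw =>
    ⟨hH.pi_mem fun x hx => (hw.1 x hx).1, hK.2 w ⟨fun x hx => (hw.1 x hx).2, hw.2⟩⟩⟩,
    fun _ hw => hH.mem fun x hx => (hw x hx).1⟩

/-- The group structure carried by a subgroup of a partial group. -/
abbrev toGroup (hH : P.IsSubgroup H) (h : IsPartialGroup P) : Group H :=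
  letI : Mul H := ⟨fun x y => ⟨P.pi [x, y], hH.mul_mem x.2 y.2⟩⟩
  letI : One H := ⟨⟨P.one, hH.one_mem⟩⟩
  letI : Inv H := ⟨fun x => ⟨P.inv x, hH.inv_mem x.2⟩⟩
  Group.ofLeftAxioms
    (fun x y z => Subtype.ext <| by
      have hw : [x.1, y.1, z.1] ∈ P.D := hH.mem (by simp)
      exact (h.assoc_pi [] [x.1, y.1] [z.1] hw).symm.trans (h.assoc_pi [x.1] [y.1, z.1] [] hw))
    (fun x => Subtype.ext (h.one_mul x.1))
    (fun x => Subtype.ext (h.inv_mul x.1))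

/-- The subgroup of `hH.toGroup` given by a subgroup contained in `H`. -/
abbrev toSubgroup (hH : P.IsSubgroup H) (h : IsPartialGroup P) (hK : P.IsSubgroup K) :
    @Subgroup H (hH.toGroup h) :=
  letI := hH.toGroup h
  { carrier := {x | x.1 ∈ K}
    mul_mem' := fun hx hy => hK.mul_mem hx hy
    one_mem' := hK.one_mem
    inv_mem' := fun hx => hK.inv_mem hx }

theorem natCard_toSubgroup (hH : P.IsSubgroup H) (h : IsPartialGroup P) (hK : P.IsSubgroup K)
    (hKH : K ⊆ H) : Nat.card (hH.toSubgroup h hK) = K.ncard := by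
  rw [← Nat.card_coe_set_eq]
  exact Nat.card_congr
    { toFun := fun x => ⟨x.1.1, x.2⟩
      invFun := fun x => ⟨⟨x.1, hKH x.2⟩, x.2⟩
      left_inv := fun _ => rfl
      right_inv := fun _ => rfl }

theorem coe_conj (hH : P.IsSubgroup H) (h : IsPartialGroup P) (x g : H) :
    letI := hH.toGroup h
    ((g⁻¹ * x * g : H) : L) = P.conj x g := by
  have hw : [P.inv g.1, x.1, g.1] ∈ P.D := hH.mem_Dconj x.2 g.2
  exact (h.assoc_pi [] [P.inv g.1, x.1] [g.1] hw).symm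

/-- The group homomorphism induced on a subgroup by a homomorphism of partial groups. -/
abbrev mapHom {P' : Data L'} {H' : Set L'} {β : L → L'} (hH : P.IsSubgroup H)
    (h : IsPartialGroup P) (hH' : P'.IsSubgroup H') (h' : IsPartialGroup P')
    (hβ : IsHom P P' β) (hm : ∀ x ∈ H, β x ∈ H') :
    letI := hH.toGroup h
    letI := hH'.toGroup h'
    H →* H' :=
  letI := hH.toGroup h
  letI := hH'.toGroup h'
  MonoidHom.mk' (fun x => ⟨β x, hm x x.2⟩) fun x y =>
    Subtype.ext (hβ.map_mul (hH.mem (by simp)))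

theorem image {P' : Data L'} {β : L → L'} (hH : P.IsSubgroup H)
    (h : IsPartialGroup P) (h' : IsPartialGroup P') (hβ : IsHom P P' β) :
    P'.IsSubgroup (β '' H) := by
  have key : ∀ w ∈ Wrd (β '' H), ∃ v ∈ Wrd H, v.map β = w := by
    intro w hw
    induction w with
    | nil => exact ⟨[], by simp [Wrd], rfl⟩
    | cons a w ih =>
      obtain ⟨⟨x, hx, rfl⟩, hw'⟩ := List.forall_mem_cons.1 hw
      obtain ⟨v, hv, rfl⟩ := ih hw'
      exact ⟨x :: v, List.forall_mem_cons.2 ⟨hx, hv⟩, rfl⟩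
  refine ⟨⟨?_, ?_⟩, ?_⟩
  · rintro _ ⟨x, hx, rfl⟩
    exact ⟨P.inv x, hH.inv_mem hx, hβ.map_inv h h' x⟩
  · rintro w ⟨hw, -⟩
    obtain ⟨v, hv, rfl⟩ := key w hw
    exact ⟨P.pi v, hH.pi_mem hv, (hβ.2 v (hH.2 hv)).symm⟩
  · intro w hw
    obtain ⟨v, hv, rfl⟩ := key w hw
    exact hβ.1 v (hH.2 hv)

end Data.IsSubgroup

/-- Conjugation control in a finite group: if a `p`-subgroup `Y` is contained in `QK` for a
Sylow subgroup `Q` and a normal subgroup `K`, then `K` conjugates `Y` into `Q`. -/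
theorem exists_conj_mem_sylow {G : Type*} [Group G] [Finite G] {p : ℕ} [Fact p.Prime]
    (Q : Sylow p G) (K Y : Subgroup G) [K.Normal] (hY : IsPGroup p Y)
    (hYQ : ∀ y ∈ Y, ∃ m ∈ Q, m⁻¹ * y ∈ K) : ∃ k ∈ K, ∀ y ∈ Y, k⁻¹ * y * k ∈ Q := by
  have hYH : Y ≤ (Q : Subgroup G) ⊔ K := by
    intro y hy
    obtain ⟨m, hm, hk⟩ := hYQ y hy
    have := Subgroup.mul_mem_sup (show m ∈ (Q : Subgroup G) from hm) hk
    simpa using this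
  set H := (Q : Subgroup G) ⊔ K with hH
  have hQH : (Q : Subgroup G) ≤ H := le_sup_left
  obtain ⟨R, hR⟩ := (hY.of_equiv (Subgroup.subgroupOfEquivOfLe hYH).symm).exists_le_sylow
  obtain ⟨⟨x, hx⟩, hxR⟩ := MulAction.exists_smul_eq H (Q.subtype hQH) R
  have hx' : x ∈ K ⊔ (Q : Subgroup G) := by rwa [sup_comm]
  rw [← SetLike.mem_coe, Subgroup.normal_mul, Set.mem_mul] at hx'
  obtain ⟨k, hk, m, hm, rfl⟩ := hx'
  refine ⟨k, hk, fun y hy => ?_⟩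
  have hyR : (⟨y, hYH hy⟩ : H) ∈ R := hR (Subgroup.mem_subgroupOf.2 hy)
  rw [← hxR, ← SetLike.mem_coe, Sylow.coe_smul, Set.mem_smul_set_iff_inv_smul_mem] at hyR
  have hyR' : (k * m)⁻¹ * y * (k * m) ∈ Q := by
    rw [← map_inv, MulAut.smul_def, MulAut.conj_apply] at hyR
    have : (k * m)⁻¹ * y * (k * m)⁻¹⁻¹ ∈ Q := hyR
    rwa [inv_inv] at this
  have := mul_mem (mul_mem (show m ∈ Q from hm) hyR') (inv_mem hm)
  simpa [mul_assoc] using this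

section PSubgroups

variable {P : Data L} {P' : Data L'} {β : L → L'} {p : ℕ} {H K A M Y : Set L}

theorem Data.IsPSubgroup.finite (hp : p.Prime) (hH : P.IsPSubgroup p H) : H.Finite := by
  obtain ⟨n, hn⟩ := hH.2
  exact Set.finite_of_ncard_pos (hn ▸ pow_pos hp.pos n)

theorem Data.IsSubgroup.isPGroup_iff (hp : p.Prime) (h : IsPartialGroup P) (hH : P.IsSubgroup H)
    (hK : P.IsSubgroup K) (hKH : K ⊆ H) (hfin : H.Finite) :
    letI := hH.toGroup h
    IsPGroup p (hH.toSubgroup h hK) ↔ P.IsPSubgroup p K := by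
  let := hH.toGroup h
  have := Fact.mk hp
  have : Finite H := hfin
  rw [IsPGroup.iff_card, hH.natCard_toSubgroup h hK hKH]
  exact ⟨fun hn => ⟨hK, hn⟩, fun hK' => hK'.2⟩

theorem Data.IsPSubgroup.isPGroup (h : IsPartialGroup P) (hH : P.IsPSubgroup p H) :
    letI := hH.1.toGroup h
    IsPGroup p H := by
  let := hH.1.toGroup h
  obtain ⟨n, hn⟩ := hH.2
  exact IsPGroup.of_card (n := n) (by rwa [Nat.card_coe_set_eq])

theorem Data.IsPSubgroup.of_subset (hp : p.Prime) (h : IsPartialGroup P) (hH : P.IsPSubgroup p H)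
    (hK : P.IsSubgroup K) (hKH : K ⊆ H) : P.IsPSubgroup p K := by
  let := hH.1.toGroup h
  exact (hH.1.isPGroup_iff hp h hK hKH (hH.finite hp)).1 ((hH.isPGroup h).to_subgroup _)

theorem Data.IsPSubgroup.image (hp : p.Prime) (h : IsPartialGroup P) (h' : IsPartialGroup P')
    (hβ : IsHom P P' β) (hH : P.IsPSubgroup p H) : P'.IsPSubgroup p (β '' H) := by
  have hH' := hH.1.image h h' hβ
  let := hH.1.toGroup h
  let := hH'.toGroup h'
  have := Fact.mk hp
  have : Finite (β '' H) := (hH.finite hp).image β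
  refine ⟨hH', ?_⟩
  rw [← Nat.card_coe_set_eq]
  refine IsPGroup.iff_card.1 ((hH.isPGroup h).of_surjective
    (hH.1.mapHom h hH' h' hβ fun x hx => ⟨x, hx, rfl⟩) ?_)
  rintro ⟨_, x, hx, rfl⟩
  exact ⟨⟨x, hx⟩, rfl⟩

/-- Normalizers grow in `p`-subgroups. -/
theorem Data.IsPSubgroup.exists_normalizing (hp : p.Prime) (h : IsPartialGroup P)
    (hH : P.IsPSubgroup p H) (hA : P.IsSubgroup A) (hAH : A ⊆ H) (hne : A ≠ H) :
    ∃ x ∈ H, x ∉ A ∧ ∀ a ∈ A, P.conj a x ∈ A := by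
  let := hH.1.toGroup h
  have := Fact.mk hp
  have : Finite H := hH.finite hp
  have := (hH.isPGroup h).isNilpotent
  have hlt : hH.1.toSubgroup h hA < ⊤ := by
    refine lt_top_iff_ne_top.2 fun he => hne (hAH.antisymm fun x hx => ?_)
    have : (⟨x, hx⟩ : H) ∈ hH.1.toSubgroup h hA := by rw [he]; trivial
    exact this
  obtain ⟨x, hx, hxA⟩ := SetLike.exists_of_lt (Group.normalizerCondition_of_isNilpotent _ hlt)
  refine ⟨x, x.2, hxA, fun a ha => ?_⟩
  have hx' := inv_mem hx
  have := (Subgroup.mem_normalizer_iff.1 hx' ⟨a, hAH ha⟩).1 ha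
  rw [inv_inv] at this
  rw [← hH.1.coe_conj h ⟨a, hAH ha⟩ x]
  exact this

/-- `M` is maximal among the `p`-subgroups contained in `H`. -/
def Data.IsMaxPSubgroupIn (P : Data L) (p : ℕ) (M H : Set L) : Prop :=
  P.IsPSubgroup p M ∧ M ⊆ H ∧ ∀ Y : Set L, P.IsPSubgroup p Y → M ⊆ Y → Y ⊆ H → Y = M

theorem Data.IsMaxPSubgroupIn.exists_sylow (hp : p.Prime) (h : IsPartialGroup P)
    (hH : P.IsSubgroup H) (hfin : H.Finite) (hM : P.IsMaxPSubgroupIn p M H) :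
    letI := hH.toGroup h
    ∃ Q : Sylow p H, ∀ x, x ∈ Q ↔ x.1 ∈ M := by
  let := hH.toGroup h
  refine ⟨⟨hH.toSubgroup h hM.1.1, (hH.isPGroup_iff hp h hM.1.1 hM.2.1 hfin).2 hM.1, ?_⟩,
    fun x => Iff.rfl⟩
  intro R hR hMR
  have hR' : P.IsSubgroup (Subtype.val '' (R : Set H)) := by
    refine Data.IsSubgroup.of_subset h hH (by rintro _ ⟨x, -, rfl⟩; exact x.2)
      ⟨1, one_mem R, rfl⟩ ?_ ?_
    · rintro _ ⟨x, hx, rfl⟩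
      exact ⟨x⁻¹, inv_mem hx, rfl⟩
    · rintro _ ⟨x, hx, rfl⟩ _ ⟨y, hy, rfl⟩
      exact ⟨x * y, mul_mem hx hy, rfl⟩
  have hsub : Subtype.val '' (R : Set H) ⊆ H := by rintro _ ⟨x, -, rfl⟩; exact x.2
  have hRe : hH.toSubgroup h hR' = R := by
    ext x
    exact ⟨fun ⟨y, hy, hyx⟩ => Subtype.ext hyx ▸ hy, fun hx => ⟨x, hx, rfl⟩⟩
  have hRp : P.IsPSubgroup p (Subtype.val '' (R : Set H)) :=
    (hH.isPGroup_iff hp h hR' hsub hfin).1 (by rwa [hRe])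
  have := hM.2.2 _ hRp (fun m hm => ⟨⟨m, hM.2.1 hm⟩, hMR hm, rfl⟩) hsub
  ext x
  refine ⟨fun hx => ?_, fun hx => hMR hx⟩
  have hx' : x.1 ∈ Subtype.val '' (R : Set H) := ⟨x, hx, rfl⟩
  rw [this] at hx'
  exact hx'

theorem Data.IsMaxPSubgroupIn.exists_conj (hp : p.Prime) (h : IsPartialGroup P)
    (hH : P.IsSubgroup H) (hfin : H.Finite) (hM : P.IsMaxPSubgroupIn p M H)
    (hK : P.IsSubgroup K) (hKn : ∀ k ∈ K, ∀ x ∈ H, P.conj k x ∈ K)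
    (hY : P.IsPSubgroup p Y) (hYH : Y ⊆ H) (hYM : ∀ y ∈ Y, ∃ m ∈ M, P.pi [P.inv m, y] ∈ K) :
    ∃ k ∈ K, ∀ y ∈ Y, P.conj y k ∈ M := by
  let := hH.toGroup h
  have := Fact.mk hp
  have : Finite H := hfin
  obtain ⟨Q, hQ⟩ := hM.exists_sylow hp h hH hfin
  have : (hH.toSubgroup h hK).Normal := by
    refine ⟨fun n hn g => ?_⟩
    have := hKn n hn (g⁻¹ : H) (g⁻¹ : H).2
    rw [← hH.coe_conj h n g⁻¹, inv_inv] at this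
    exact this
  obtain ⟨k, hk, hkY⟩ := exists_conj_mem_sylow Q (hH.toSubgroup h hK) (hH.toSubgroup h hY.1)
    ((hH.isPGroup_iff hp h hY.1 hYH hfin).2 hY) (by
      intro y hy
      obtain ⟨m, hm, hmy⟩ := hYM y hy
      exact ⟨⟨m, hM.2.1 hm⟩, (hQ _).2 hm, hmy⟩)
  refine ⟨k, hk, fun y hy => ?_⟩
  have := (hQ _).1 (hkY ⟨y, hYH hy⟩ hy)
  rwa [hH.coe_conj h] at this

theorem Data.IsMaxPSubgroupIn.image_eq (hp : p.Prime) (h : IsPartialGroup P)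
    (h' : IsPartialGroup P') (hβ : IsHom P P' β)
    (hH : P.IsSubgroup H) (hfin : H.Finite) (hM : P.IsMaxPSubgroupIn p M H)
    (hHp : P'.IsPSubgroup p (β '' H)) : β '' H = β '' M := by
  let := hH.toGroup h
  let := hHp.1.toGroup h'
  have := Fact.mk hp
  have : Finite H := hfin
  obtain ⟨Q, hQ⟩ := hM.exists_sylow hp h hH hfin
  let φ := hH.mapHom h hHp.1 h' hβ fun x hx => ⟨x, hx, rfl⟩
  have hφ : Function.Surjective φ := by
    rintro ⟨_, x, hx, rfl⟩
    exact ⟨⟨x, hx⟩, rfl⟩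
  have htop : (⊤ : Subgroup (β '' H)) = Q.mapSurjective hφ :=
    (Q.mapSurjective hφ).3 ((hHp.isPGroup h').to_subgroup ⊤) le_top
  refine Set.Subset.antisymm ?_ (Set.image_mono hM.2.1)
  rintro z hz
  have hz' : (⟨z, hz⟩ : (β '' H : Set L')) ∈ (⊤ : Subgroup (β '' H)) := trivial
  rw [htop, Sylow.coe_mapSurjective] at hz'
  obtain ⟨x, hx, hxz⟩ := hz'
  exact ⟨x.1, (hQ x).1 hx, congrArg Subtype.val hxz⟩

end PSubgroups

/-- `g ∈ L₀` conjugates the object `A` onto the object `B`. -/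
structure Conjugates (P : Data L) (L₀ : Set L) (Δ : Set (Set L)) (g : L) (A B : Set L) :
    Prop where
  mem : g ∈ L₀
  left : A ∈ Δ
  right : B ∈ Δ
  sub : A ⊆ P.Dconj g
  eq : P.conjSet A g = B

/-- The elements of `L₀` normalizing the object `A`. -/
def objNormalizer (P : Data L) (L₀ : Set L) (Δ : Set (Set L)) (A : Set L) : Set L :=
  {g | Conjugates P L₀ Δ g A A}

/-- The word `w` over `L₀` acts by conjugation on the object `A`. -/
def ActsOn (P : Data L) (L₀ : Set L) (Δ : Set (Set L)) (w : List L) (A : Set L) : Prop :=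
  w ∈ Wrd L₀ ∧ chainFrom P Δ w A

section Localities

variable {p : ℕ} {P : Data L} {L₀ : Set L} {Δ : Set (Set L)} {S : Set L}
  {P' : Data L'} {β : L → L'}
  {A B C X Y V : Set L} {f g k x y : L} {w : List L}

namespace Conjugates

theorem conj_mem (t : Conjugates P L₀ Δ g A B) (hx : x ∈ A) : P.conj x g ∈ B :=
  t.eq ▸ ⟨x, hx, rfl⟩

theorem nil : ActsOn P L₀ Δ [] A := ⟨by simp [Wrd], trivial⟩

theorem cons (t : Conjugates P L₀ Δ g A B) (hw : ActsOn P L₀ Δ w B) :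
    ActsOn P L₀ Δ (g :: w) A :=
  ⟨List.forall_mem_cons.2 ⟨t.mem, hw.1⟩, t.sub, t.eq.symm ▸ t.right, t.eq.symm ▸ hw.2⟩

theorem inv (h : IsPartialGroup P) (hL : P.IsPartialSubgroup L₀)
    (t : Conjugates P L₀ Δ g A B) : Conjugates P L₀ Δ (P.inv g) B A := by
  refine ⟨hL.1 _ t.mem, t.right, t.left, ?_, ?_⟩
  · rw [← t.eq]
    rintro _ ⟨x, hx, rfl⟩
    exact h.conj_mem_Dconj_inv (t.sub hx)
  · rw [← t.eq, Data.conjSet, Data.conjSet, Set.image_image]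
    exact (Set.image_congr fun x hx => h.conj_conj_inv (t.sub hx)).trans (Set.image_id A)

theorem ncard_eq (h : IsPartialGroup P) (t : Conjugates P L₀ Δ g A B) : A.ncard = B.ncard := by
  rw [← t.eq]
  exact (((h.conj_injOn g).mono t.sub).ncard_image).symm

theorem image_eq (h : IsPartialGroup P) (h' : IsPartialGroup P') (hβ : IsHom P P' β)
    (t : Conjugates P L₀ Δ g A B) : β '' B = P'.conjSet (β '' A) (β g) := by
  rw [← t.eq, hβ.image_conjSet h h' t.sub]

end Conjugates

namespace IsLocalityIn

theorem subgroup (hl : IsLocalityIn p P L₀ Δ S) (hA : A ∈ Δ) : P.IsSubgroup A :=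
  (hl.delta_subgroups A hA).1

theorem subset (hl : IsLocalityIn p P L₀ Δ S) (hA : A ∈ Δ) : A ⊆ S :=
  (hl.delta_subgroups A hA).2

theorem finite_sub (hl : IsLocalityIn p P L₀ Δ S) (hX : X ⊆ S) : X.Finite :=
  (hl.finite.subset hl.s_sub).subset hX

theorem mem_D (hl : IsLocalityIn p P L₀ Δ S) (hA : A ∈ Δ) (hw : ActsOn P L₀ Δ w A) : w ∈ P.D :=
  (hl.d_eq w hw.1).2 ⟨A, hA, hw.2⟩

theorem conjugates_self (h : IsPartialGroup P) (hl : IsLocalityIn p P L₀ Δ S) (hA : A ∈ Δ)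
    (hx : x ∈ A) : Conjugates P L₀ Δ x A A := by
  have hs := hl.subgroup hA
  refine ⟨hl.s_sub (hl.subset hA hx), hA, hA, fun a ha => hs.mem_Dconj ha hx, ?_⟩
  refine Set.Subset.antisymm ?_ fun a ha => ?_
  · rintro _ ⟨a, ha, rfl⟩
    exact hs.conj_mem ha hx
  · refine ⟨P.conj a (P.inv x), hs.conj_mem ha (hs.inv_mem hx), ?_⟩
    have := h.conj_conj_inv (hs.mem_Dconj ha (hs.inv_mem hx))
    rwa [h.inv_inv] at this

theorem conj_word_mem (h : IsPartialGroup P) (hl : IsLocalityIn p P L₀ Δ S)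
    (t : Conjugates P L₀ Δ g A B) (t' : Conjugates P L₀ Δ k B C)
    (hx : x ∈ objNormalizer P L₀ Δ A) : [P.inv k, P.inv g, x, g, k] ∈ P.D :=
  hl.mem_D t'.right <| (t'.inv h hl.partialSubgroup).cons <| (t.inv h hl.partialSubgroup).cons <|
    Conjugates.cons hx <| t.cons <| t'.cons Conjugates.nil

theorem mul_mem_D (hl : IsLocalityIn p P L₀ Δ S)
    (t : Conjugates P L₀ Δ g A B) (t' : Conjugates P L₀ Δ k B C) : [g, k] ∈ P.D :=
  hl.mem_D t.left <| t.cons <| t'.cons Conjugates.nil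

theorem conjugates_mul (h : IsPartialGroup P) (hl : IsLocalityIn p P L₀ Δ S)
    (t : Conjugates P L₀ Δ g A B) (t' : Conjugates P L₀ Δ k B C) :
    Conjugates P L₀ Δ (P.pi [g, k]) A C := by
  have hw : ∀ x ∈ A, [P.inv k, P.inv g, x, g, k] ∈ P.D := fun x hx =>
    hl.conj_word_mem h t t' (hl.conjugates_self h t.left hx)
  refine ⟨hl.partialSubgroup.2 _ ⟨?_, hl.mul_mem_D t t'⟩, t.left, t'.right,
    fun x hx => h.mem_Dconj_mul (hw x hx), ?_⟩
  · simp [Wrd, t.mem, t'.mem]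
  · rw [← t'.eq, ← t.eq, Data.conjSet, Data.conjSet, Data.conjSet, Set.image_image]
    exact Set.image_congr fun x hx => h.conj_conj (hw x hx)

theorem conj_mul (h : IsPartialGroup P) (hl : IsLocalityIn p P L₀ Δ S)
    (t : Conjugates P L₀ Δ g A B) (t' : Conjugates P L₀ Δ k B C)
    (hx : x ∈ objNormalizer P L₀ Δ A) : P.conj x (P.pi [g, k]) = P.conj (P.conj x g) k :=
  h.conj_conj (hl.conj_word_mem h t t' hx)

theorem objNormalizer_subset : objNormalizer P L₀ Δ A ⊆ L₀ := fun _ hx => hx.mem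

theorem subset_objNormalizer (h : IsPartialGroup P) (hl : IsLocalityIn p P L₀ Δ S) (hA : A ∈ Δ) :
    A ⊆ objNormalizer P L₀ Δ A := fun _ hx => hl.conjugates_self h hA hx

theorem objNormalizer_isSubgroup (h : IsPartialGroup P) (hl : IsLocalityIn p P L₀ Δ S)
    (hA : A ∈ Δ) : P.IsSubgroup (objNormalizer P L₀ Δ A) := by
  refine Data.IsSubgroup.of_words h ?_ (hl.conjugates_self h hA (hl.subgroup hA).one_mem)
    (fun x hx => Conjugates.inv h hl.partialSubgroup hx)
    (fun x hx y hy => hl.conjugates_mul h hx hy)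
  intro w hw
  refine hl.mem_D hA ?_
  induction w with
  | nil => exact Conjugates.nil
  | cons a w ih =>
    have hw' := List.forall_mem_cons.1 hw
    exact Conjugates.cons hw'.1 (ih hw'.2)

theorem mem_Dconj (h : IsPartialGroup P) (hl : IsLocalityIn p P L₀ Δ S)
    (t : Conjugates P L₀ Δ g A B) (hx : x ∈ objNormalizer P L₀ Δ A) : x ∈ P.Dconj g :=
  hl.mem_D t.right <| (t.inv h hl.partialSubgroup).cons <| Conjugates.cons hx <|
    t.cons Conjugates.nil

theorem conj_mem_objNormalizer (h : IsPartialGroup P) (hl : IsLocalityIn p P L₀ Δ S)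
    (t : Conjugates P L₀ Δ g A B) (hx : x ∈ objNormalizer P L₀ Δ A) :
    P.conj x g ∈ objNormalizer P L₀ Δ B := by
  have e : P.conj x g = P.pi [P.pi [P.inv g, x], g] :=
    h.assoc_pi [] [P.inv g, x] [g] (hl.mem_Dconj h t hx)
  rw [e]
  exact hl.conjugates_mul h (hl.conjugates_mul h (t.inv h hl.partialSubgroup) hx) t

theorem conjSet_isSubgroup (h : IsPartialGroup P) (hl : IsLocalityIn p P L₀ Δ S)
    (t : Conjugates P L₀ Δ g A B) (hY : P.IsSubgroup Y) (hYA : Y ⊆ objNormalizer P L₀ Δ A) :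
    P.IsSubgroup (P.conjSet Y g) := by
  refine Data.IsSubgroup.of_subset h (hl.objNormalizer_isSubgroup h t.right) ?_ ?_ ?_ ?_
  · rintro _ ⟨y, hy, rfl⟩
    exact hl.conj_mem_objNormalizer h t (hYA hy)
  · exact ⟨P.one, hY.one_mem, h.one_conj g⟩
  · rintro _ ⟨y, hy, rfl⟩
    exact ⟨P.inv y, hY.inv_mem hy, h.conj_inv (hl.mem_Dconj h t (hYA hy))⟩
  · rintro _ ⟨x, hx, rfl⟩ _ ⟨y, hy, rfl⟩
    refine ⟨P.pi [x, y], hY.mul_mem hx hy, h.conj_mul ?_⟩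
    have ti := t.inv h hl.partialSubgroup
    exact hl.mem_D t.right <| ti.cons <| Conjugates.cons (hYA hx) <| t.cons <| ti.cons <|
      Conjugates.cons (hYA hy) <| t.cons Conjugates.nil

theorem ncard_conjSet (h : IsPartialGroup P) (hl : IsLocalityIn p P L₀ Δ S)
    (t : Conjugates P L₀ Δ g A B) (hYA : Y ⊆ objNormalizer P L₀ Δ A) :
    (P.conjSet Y g).ncard = Y.ncard :=
  ((h.conj_injOn g).mono fun _ hy => hl.mem_Dconj h t (hYA hy)).ncard_image

theorem conjSet_isPSubgroup (h : IsPartialGroup P) (hl : IsLocalityIn p P L₀ Δ S)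
    (t : Conjugates P L₀ Δ g A B) (hY : P.IsPSubgroup p Y) (hYA : Y ⊆ objNormalizer P L₀ Δ A) :
    P.IsPSubgroup p (P.conjSet Y g) :=
  ⟨hl.conjSet_isSubgroup h t hY.1 hYA, by rw [hl.ncard_conjSet h t hYA]; exact hY.2⟩

theorem conjugates_conjSet (h : IsPartialGroup P) (hl : IsLocalityIn p P L₀ Δ S)
    (t : Conjugates P L₀ Δ g A B) (hY : Y ∈ Δ) (hYA : Y ⊆ objNormalizer P L₀ Δ A)
    (hYS : P.conjSet Y g ⊆ S) : Conjugates P L₀ Δ g Y (P.conjSet Y g) := by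
  have hD : Y ⊆ P.Dconj g := fun y hy => hl.mem_Dconj h t (hYA hy)
  exact ⟨t.mem, hY, hl.delta_closed _ (hl.conjSet_isSubgroup h t (hl.subgroup hY) hYA) hYS
    ⟨Y, hY, g, t.mem, hD, Set.Subset.rfl⟩, hD, rfl⟩

theorem restrict (h : IsPartialGroup P) (hl : IsLocalityIn p P L₀ Δ S)
    (t : Conjugates P L₀ Δ g X Y) (hA : A ∈ Δ) (hAX : A ⊆ X) :
    Conjugates P L₀ Δ g A (P.conjSet A g) := by
  refine hl.conjugates_conjSet h t hA (hAX.trans (hl.subset_objNormalizer h t.left)) ?_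
  refine Set.Subset.trans ?_ (hl.subset t.right)
  rw [← t.eq]
  exact Set.image_mono hAX

theorem mem_of_subset (h : IsPartialGroup P) (hl : IsLocalityIn p P L₀ Δ S) (hA : A ∈ Δ)
    (hX : P.IsSubgroup X) (hXS : X ⊆ S) (hAX : A ⊆ X) : X ∈ Δ := by
  refine hl.delta_closed X hX hXS ⟨A, hA, P.one, hl.s_sub (hXS hX.one_mem),
    fun x _ => h.mem_Dconj_one x, ?_⟩
  rintro _ ⟨x, hx, rfl⟩
  show P.conj x P.one ∈ X
  rw [h.conj_one]
  exact hAX hx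

theorem s_mem (h : IsPartialGroup P) (hl : IsLocalityIn p P L₀ Δ S) : S ∈ Δ := by
  obtain ⟨A, hA⟩ := hl.delta_nonempty
  exact hl.mem_of_subset h hA hl.pSubgroup.1 Set.Subset.rfl (hl.subset hA)

theorem conjugates_of_mem (h : IsPartialGroup P) (hl : IsLocalityIn p P L₀ Δ S) (hA : A ∈ Δ)
    (hx : x ∈ S) : Conjugates P L₀ Δ x A (P.conjSet A x) :=
  hl.restrict h (hl.conjugates_self h (hl.s_mem h) hx) hA (hl.subset hA)

theorem conjugates_of_subset (h : IsPartialGroup P) (hl : IsLocalityIn p P L₀ Δ S) (hA : A ∈ Δ)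
    (hg : g ∈ L₀) (hD : A ⊆ P.Dconj g) (hgA : ∀ a ∈ A, P.conj a g ∈ A) :
    Conjugates P L₀ Δ g A A := by
  refine ⟨hg, hA, hA, hD, Set.eq_of_subset_of_ncard_le ?_ ?_ (hl.finite_sub (hl.subset hA))⟩
  · rintro _ ⟨a, ha, rfl⟩
    exact hgA a ha
  · exact ((h.conj_injOn g).mono hD).ncard_image.ge

theorem exists_conjugates (hl : IsLocalityIn p P L₀ Δ S)
    (h : IsPartialGroup P) (hg : g ∈ L₀) : ∃ A B, Conjugates P L₀ Δ g A B := by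
  obtain ⟨A, hA, hD, hB, -⟩ := (hl.d_eq [g] (by simpa [Wrd] using hg)).1 (h.singleton_mem g)
  exact ⟨A, _, hg, hA, hB, hD, rfl⟩

theorem inter_objNormalizer_isPSubgroup (hp : p.Prime) (h : IsPartialGroup P)
    (hl : IsLocalityIn p P L₀ Δ S) (hA : A ∈ Δ) (hX : P.IsSubgroup X) (hXS : X ⊆ S) :
    P.IsPSubgroup p (X ∩ objNormalizer P L₀ Δ A) :=
  hl.pSubgroup.of_subset hp h (hX.inter (hl.objNormalizer_isSubgroup h hA).1)
    (Set.inter_subset_left.trans hXS)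

theorem inter_objNormalizer_mem (h : IsPartialGroup P)
    (hl : IsLocalityIn p P L₀ Δ S) (hA : A ∈ Δ) (hX : P.IsSubgroup X) (hXS : X ⊆ S)
    (hAX : A ⊆ X) : X ∩ objNormalizer P L₀ Δ A ∈ Δ :=
  hl.mem_of_subset h hA (hX.inter (hl.objNormalizer_isSubgroup h hA).1)
    (Set.inter_subset_left.trans hXS) (Set.subset_inter hAX (hl.subset_objNormalizer h hA))

theorem ncard_lt_inter_objNormalizer (hp : p.Prime) (h : IsPartialGroup P)
    (hl : IsLocalityIn p P L₀ Δ S) (hA : A ∈ Δ) (hX : P.IsSubgroup X) (hXS : X ⊆ S)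
    (hAX : A ⊆ X) (hne : A ≠ X) : A.ncard < (X ∩ objNormalizer P L₀ Δ A).ncard := by
  obtain ⟨x, hx, hxA, hxn⟩ := (hl.pSubgroup.of_subset hp h hX hXS).exists_normalizing hp h
    (hl.subgroup hA) hAX hne
  refine Set.ncard_lt_ncard ⟨Set.subset_inter hAX (hl.subset_objNormalizer h hA), fun hs => ?_⟩
    (hl.finite_sub (Set.inter_subset_left.trans hXS))
  exact hxA (hs ⟨hx, hl.conjugates_of_subset h hA (hl.s_sub (hXS hx))
    (fun a ha => hX.mem_Dconj (hAX ha) hx) hxn⟩)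

theorem exists_max_normalizer (hp : p.Prime) (h : IsPartialGroup P)
    (hl : IsLocalityIn p P L₀ Δ S) (hA : A ∈ Δ) :
    ∃ g V, Conjugates P L₀ Δ g A V ∧
      P.IsMaxPSubgroupIn p (S ∩ objNormalizer P L₀ Δ V) (objNormalizer P L₀ Δ V) := by
  induction hn : S.ncard - A.ncard using Nat.strong_induction_on generalizing A with
  | _ n ih =>
  have hSfin : S.Finite := hl.finite_sub Set.Subset.rfl
  have hclass : {V | ∃ g, Conjugates P L₀ Δ g A V}.Finite :=
    hSfin.finite_subsets.subset fun V ⟨g, t⟩ => hl.subset t.right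
  obtain ⟨V, ⟨g, t⟩, hmax⟩ := Set.exists_max_image _
    (fun V => (S ∩ objNormalizer P L₀ Δ V).ncard) hclass
    ⟨A, P.one, hl.conjugates_self h hA (hl.subgroup hA).one_mem⟩
  have hmax' : ∀ V' g', Conjugates P L₀ Δ g' A V' → (S ∩ objNormalizer P L₀ Δ V').ncard ≤
      (S ∩ objNormalizer P L₀ Δ V).ncard := fun V' g' t' => hmax V' ⟨g', t'⟩
  by_cases hVS : V = S
  · subst hVS
    have hV : V ∩ objNormalizer P L₀ Δ V = V :=
      Set.inter_eq_left.2 (hl.subset_objNormalizer h t.right)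
    refine ⟨g, V, t, ?_⟩
    rw [hV]
    exact ⟨hl.pSubgroup, hl.subset_objNormalizer h t.right, fun Y hY hVY hYn =>
      hl.s_maximal Y (hYn.trans objNormalizer_subset) hY hVY⟩
  set R := S ∩ objNormalizer P L₀ Δ V with hR
  have hVR : V.ncard < R.ncard := hl.ncard_lt_inter_objNormalizer hp h t.right hl.pSubgroup.1
    Set.Subset.rfl (hl.subset t.right) hVS
  have hRΔ : R ∈ Δ := hl.inter_objNormalizer_mem h t.right hl.pSubgroup.1 Set.Subset.rfl
    (hl.subset t.right)
  have hRS : R.ncard ≤ S.ncard := Set.ncard_le_ncard Set.inter_subset_left hSfin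
  have hAV := t.ncard_eq h
  obtain ⟨k, W, tW, hW⟩ := ih (S.ncard - R.ncard) (by omega) hRΔ rfl
  have hVsub : V ⊆ R := Set.subset_inter (hl.subset t.right) (hl.subset_objNormalizer h t.right)
  have t₂ := hl.restrict h tW t.right hVsub
  set V₂ := P.conjSet V k
  have hgk := hl.conjugates_mul h t t₂
  have hV₂W : V₂ ⊆ W := by
    rw [← tW.eq]
    exact Set.image_mono hVsub
  have hWn : W ⊆ S ∩ objNormalizer P L₀ Δ V₂ := by
    refine Set.subset_inter (hl.subset tW.right) ?_
    rw [← tW.eq]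
    rintro _ ⟨r, hr, rfl⟩
    exact hl.conj_mem_objNormalizer h t₂ hr.2
  have hWcard := tW.ncard_eq h
  have hWe : W = S ∩ objNormalizer P L₀ Δ V₂ :=
    Set.eq_of_subset_of_ncard_le hWn (by have := hmax' _ _ hgk; omega)
      (hSfin.subset Set.inter_subset_left)
  refine ⟨_, V₂, hgk, ?_⟩
  rw [← hWe]
  refine ⟨hl.pSubgroup.of_subset hp h (hl.subgroup tW.right) (hl.subset tW.right),
    hWn.trans Set.inter_subset_right, fun Y hY hWY hYn => ?_⟩
  by_contra hne
  obtain ⟨y, hyY, hyW, hy⟩ := hY.exists_normalizing hp h (hl.subgroup tW.right) hWY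
    (fun e => hne e.symm)
  have hyn : y ∈ objNormalizer P L₀ Δ W := hl.conjugates_of_subset h tW.right (hYn hyY).mem
    (fun a ha => hY.1.mem_Dconj (hWY ha) hyY) hy
  have hNW := hl.objNormalizer_isSubgroup h tW.right
  set Z := Y ∩ objNormalizer P L₀ Δ W
  have hZ : P.IsPSubgroup p Z :=
    hY.of_subset hp h (hY.1.inter hNW.1) Set.inter_subset_left
  have hWZ : W.ncard < Z.ncard := Set.ncard_lt_ncard
    ⟨Set.subset_inter hWY (hl.subset_objNormalizer h tW.right), fun hs => hyW (hs ⟨hyY, hyn⟩)⟩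
    (hZ.finite hp)
  obtain ⟨m, hm, hmZ⟩ := hW.exists_conj hp h hNW (hl.finite.subset objNormalizer_subset) hNW
    (fun k hk x hx => hNW.conj_mem hk hx) hZ Set.inter_subset_right
    (fun z hz => ⟨P.one, hW.1.1.one_mem,
      hNW.mul_mem (hNW.inv_mem hNW.one_mem) hz.2⟩)
  have t₃ := hl.restrict h hm t₂.right hV₂W
  have hle := hmax' _ _ (hl.conjugates_mul h hgk t₃)
  have hZn : Z ⊆ objNormalizer P L₀ Δ V₂ := Set.inter_subset_left.trans hYn
  have hle' : (P.conjSet Z m).ncard ≤ (S ∩ objNormalizer P L₀ Δ (P.conjSet V₂ m)).ncard := by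
    refine Set.ncard_le_ncard ?_ (hSfin.subset Set.inter_subset_left)
    rintro _ ⟨z, hz, rfl⟩
    exact ⟨(hmZ z hz).1, hl.conj_mem_objNormalizer h t₃ (hZn hz)⟩
  rw [hl.ncard_conjSet h t₃ hZn] at hle'
  omega

/-- Every object is conjugate to one whose normalizer in `S` is a Sylow subgroup of its
normalizer in `L₀`, by an element conjugating its normalizer in `S` into `S`. -/
theorem exists_fully_normalized (hp : p.Prime) (h : IsPartialGroup P)
    (hl : IsLocalityIn p P L₀ Δ S) (hA : A ∈ Δ) :
    ∃ g V, Conjugates P L₀ Δ g A V ∧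
      P.IsMaxPSubgroupIn p (S ∩ objNormalizer P L₀ Δ V) (objNormalizer P L₀ Δ V) ∧
      ∀ x ∈ S ∩ objNormalizer P L₀ Δ A, P.conj x g ∈ S := by
  obtain ⟨g, V, t, hV⟩ := hl.exists_max_normalizer hp h hA
  have hN := hl.objNormalizer_isSubgroup h t.right
  obtain ⟨m, hm, hmY⟩ := hV.exists_conj hp h hN (hl.finite.subset objNormalizer_subset) hN
    (fun k hk x hx => hN.conj_mem hk hx)
    (hl.conjSet_isPSubgroup h t (hl.inter_objNormalizer_isPSubgroup hp h hA hl.pSubgroup.1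
      Set.Subset.rfl) Set.inter_subset_right)
    (by rintro _ ⟨x, hx, rfl⟩; exact hl.conj_mem_objNormalizer h t hx.2)
    (by
      rintro _ ⟨x, hx, rfl⟩
      exact ⟨P.one, hV.1.1.one_mem,
        hN.mul_mem (hN.inv_mem hN.one_mem) (hl.conj_mem_objNormalizer h t hx.2)⟩)
  refine ⟨_, V, hl.conjugates_mul h t hm, hV, fun x hx => ?_⟩
  rw [hl.conj_mul h t hm hx.2]
  exact (hmY _ ⟨x, hx, rfl⟩).1

end IsLocalityIn

/-- The largest subset of `S` with the same image under `β` as `X ⊆ S`. -/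
def kerHull (S : Set L) (β : L → L') (X : Set L) : Set L := S ∩ β ⁻¹' (β '' X)

theorem subset_kerHull (hX : X ⊆ S) : X ⊆ kerHull S β X :=
  fun _ hx => ⟨hX hx, Set.mem_image_of_mem β hx⟩

theorem image_kerHull (hX : X ⊆ S) : β '' kerHull S β X = β '' X :=
  Set.Subset.antisymm (Set.image_subset_iff.2 Set.inter_subset_right)
    (Set.image_mono (subset_kerHull hX))

theorem kerHull_congr (hXY : β '' X = β '' Y) : kerHull S β X = kerHull S β Y := by
  rw [kerHull, kerHull, hXY]

theorem Data.IsSubgroup.inter_preimage (h : IsPartialGroup P) (h' : IsPartialGroup P')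
    (hβ : IsHom P P' β) (hS : P.IsSubgroup S) {T : Set L'} (hT : P'.IsSubgroup T) :
    P.IsSubgroup (S ∩ β ⁻¹' T) := by
  refine Data.IsSubgroup.of_subset h hS Set.inter_subset_left ⟨hS.one_mem, ?_⟩ ?_ ?_
  · rw [Set.mem_preimage, hβ.map_one h]
    exact hT.one_mem
  · rintro x ⟨hx, hx'⟩
    refine ⟨hS.inv_mem hx, ?_⟩
    rw [Set.mem_preimage, hβ.map_inv h h']
    exact hT.inv_mem hx'
  · rintro x ⟨hx, hx'⟩ y ⟨hy, hy'⟩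
    refine ⟨hS.mul_mem hx hy, ?_⟩
    rw [Set.mem_preimage, hβ.map_mul (hS.mem (by simp [hx, hy]))]
    exact hT.mul_mem hx' hy'

/-- The elements `s` of `S` such that `(sβ)^f` is defined and lies in `Sβ`. -/
def conjDom (P' : Data L') (β : L → L') (S : Set L) (f : L') : Set L :=
  {s | s ∈ S ∧ β s ∈ P'.Dconj f ∧ P'.conj (β s) f ∈ β '' S}

namespace IsLocalityIn

theorem exists_conj_ker (hp : p.Prime) (h : IsPartialGroup P) (h' : IsPartialGroup P')
    (hβ : IsHom P P' β) (hl : IsLocalityIn p P L₀ Δ S) (hV : V ∈ Δ)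
    (hmax : P.IsMaxPSubgroupIn p (S ∩ objNormalizer P L₀ Δ V) (objNormalizer P L₀ Δ V))
    (hY : P.IsPSubgroup p Y) (hYV : Y ⊆ objNormalizer P L₀ Δ V)
    (hYS : ∀ y ∈ Y, ∃ m ∈ S ∩ objNormalizer P L₀ Δ V, β m = β y) :
    ∃ k, Conjugates P L₀ Δ k V V ∧ β k = P'.one ∧ ∀ y ∈ Y, P.conj y k ∈ S := by
  have hN := hl.objNormalizer_isSubgroup h hV
  have hK : P.IsSubgroup (objNormalizer P L₀ Δ V ∩ β ⁻¹' {P'.one}) := by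
    refine Data.IsSubgroup.of_subset h hN Set.inter_subset_left
      ⟨hN.one_mem, hβ.map_one h⟩ ?_ ?_
    · rintro x ⟨hx, hx' : β x = _⟩
      refine ⟨hN.inv_mem hx, ?_⟩
      show β _ = _
      rw [hβ.map_inv h h', hx', h'.inv_one]
    · rintro x ⟨hx, hx' : β x = _⟩ y ⟨hy, hy' : β y = _⟩
      refine ⟨hN.mul_mem hx hy, ?_⟩
      show β _ = _
      rw [hβ.map_mul (hN.mem (by simp [hx, hy])), hx', hy', h'.one_mul]
  obtain ⟨k, hk, hkY⟩ := hmax.exists_conj hp h hN (hl.finite.subset objNormalizer_subset) hK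
    (fun k hk x hx => ⟨hN.conj_mem hk.1 hx, by
      show β _ = _
      rw [hβ.map_conj h h' (hN.mem_Dconj hk.1 hx), show β k = _ from hk.2, h'.one_conj]⟩)
    hY hYV (fun y hy => by
      obtain ⟨m, hm, e⟩ := hYS y hy
      refine ⟨m, hm, hN.mul_mem (hN.inv_mem hm.2) (hYV hy), ?_⟩
      show β _ = _
      rw [hβ.map_mul (hN.mem (by simp [hN.inv_mem hm.2, hYV hy])), hβ.map_inv h h', e,
        h'.inv_mul])
  exact ⟨k, hk.1, hk.2, fun y hy => (hkY y hy).1⟩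

theorem kerHull_isSubgroup (h : IsPartialGroup P) (h' : IsPartialGroup P')
    (hβ : IsHom P P' β) (hl : IsLocalityIn p P L₀ Δ S) (hX : X ∈ Δ) :
    P.IsSubgroup (kerHull S β X) :=
  hl.pSubgroup.1.inter_preimage h h' hβ ((hl.subgroup hX).image h h' hβ)

theorem kerHull_mem (h : IsPartialGroup P) (h' : IsPartialGroup P')
    (hβ : IsHom P P' β) (hl : IsLocalityIn p P L₀ Δ S) (hX : X ∈ Δ) : kerHull S β X ∈ Δ :=
  hl.mem_of_subset h hX (hl.kerHull_isSubgroup h h' hβ hX) Set.inter_subset_left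
    (subset_kerHull (hl.subset hX))

theorem kerHull_subset_of_conjugates (h : IsPartialGroup P) (h' : IsPartialGroup P')
    (hβ : IsHom P P' β) (hl : IsLocalityIn p P L₀ Δ S) (t : Conjugates P L₀ Δ g X Y)
    (hX : kerHull S β X ⊆ X) : kerHull S β Y ⊆ Y := by
  have hS := hl.pSubgroup.1
  set T : Set L := {s | s ∈ S ∧ β s = P'.one}
  have hTX : T ⊆ X := fun s hs =>
    hX ⟨hs.1, P.one, (hl.subgroup t.left).one_mem, (hβ.map_one h).trans hs.2.symm⟩
  have hT : P.conjSet T g ⊆ T := by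
    rintro _ ⟨s, hs, rfl⟩
    refine ⟨hl.subset t.right (t.conj_mem (hTX hs)), ?_⟩
    rw [hβ.map_conj h h' (t.sub (hTX hs)), hs.2, h'.one_conj]
  have hTe : P.conjSet T g = T := Set.eq_of_subset_of_ncard_le hT
    ((h.conj_injOn g).mono (hTX.trans t.sub)).ncard_image.ge
    (hl.finite_sub fun s hs => hs.1)
  have hTY : T ⊆ Y := by
    rw [← hTe, ← t.eq]
    exact Set.image_mono hTX
  rintro s ⟨hs, y, hy, e⟩
  have hyS := hl.subset t.right hy
  have hw : [y, P.inv y, s] ∈ P.D := hS.mem (by simp [hyS, hs, hS.inv_mem hyS])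
  have e1 := h.assoc_pi [y] [P.inv y, s] [] hw
  have e2 := h.assoc_pi [] [y, P.inv y] [s] hw
  simp only [List.nil_append, List.cons_append, List.append_nil, h.mul_inv, h.one_mul] at e1 e2
  rw [← e2, e1]
  refine (hl.subgroup t.right).mul_mem hy (hTY ⟨hS.mul_mem (hS.inv_mem hyS) hs, ?_⟩)
  rw [hβ.map_mul (h.append_right [y] _ hw), hβ.map_inv h h', e, h'.inv_mul]

theorem mem_objNormalizer_of_map_eq (h : IsPartialGroup P) (h' : IsPartialGroup P')
    (hβ : IsHom P P' β) (hl : IsLocalityIn p P L₀ Δ S) (hX : kerHull S β X ⊆ X)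
    (hy : y ∈ objNormalizer P L₀ Δ X) (hx : x ∈ S) (e : β x = β y) :
    x ∈ objNormalizer P L₀ Δ X := by
  have hXS := hl.subset hy.left
  have hS := hl.pSubgroup.1
  refine hl.conjugates_of_subset h hy.left (hl.s_sub hx)
    (fun a ha => hS.mem_Dconj (hXS ha) hx) fun a ha => hX ⟨hS.conj_mem (hXS ha) hx,
      P.conj a y, hy.conj_mem ha, ?_⟩
  rw [hβ.map_conj h h' (hy.sub ha), hβ.map_conj h h' (hS.mem_Dconj (hXS ha) hx), e]

theorem map_mul_ker (h' : IsPartialGroup P') (hβ : IsHom P P' β)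
    (hl : IsLocalityIn p P L₀ Δ S) (t : Conjugates P L₀ Δ g A B)
    (t' : Conjugates P L₀ Δ k B C) (hk : β k = P'.one) : β (P.pi [g, k]) = β g := by
  rw [hβ.map_mul (hl.mul_mem_D t t'), hk, h'.mul_one]

theorem exists_conjugates_kerHull (hp : p.Prime) (h : IsPartialGroup P) (h' : IsPartialGroup P')
    (hβ : IsHom P P' β) (hl : IsLocalityIn p P L₀ Δ S) (t : Conjugates P L₀ Δ g A B) :
    ∃ g', β g' = β g ∧ Conjugates P L₀ Δ g' (kerHull S β A) (kerHull S β B) := by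
  induction hn : S.ncard - A.ncard using Nat.strong_induction_on generalizing g A B with
  | _ n ih =>
  have hSfin : S.Finite := hl.finite_sub Set.Subset.rfl
  have key : ∀ {C V : Set L} {a : L}, Conjugates P L₀ Δ a C V → C.ncard = A.ncard →
      P.IsMaxPSubgroupIn p (S ∩ objNormalizer P L₀ Δ V) (objNormalizer P L₀ Δ V) →
      ∃ a', β a' = β a ∧ Conjugates P L₀ Δ a' (kerHull S β C) (kerHull S β V) := by
    intro C V a ta hC hV
    have hCS := hl.subset ta.left
    by_cases hs : kerHull S β C ⊆ C
    · refine ⟨a, rfl, ?_⟩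
      rwa [hs.antisymm (subset_kerHull hCS),
        (hl.kerHull_subset_of_conjugates h h' hβ ta hs).antisymm
          (subset_kerHull (hl.subset ta.right))]
    set Y := kerHull S β C ∩ objNormalizer P L₀ Δ C
    have hYS : Y ⊆ S := Set.inter_subset_left.trans Set.inter_subset_left
    have hCsub := hl.kerHull_isSubgroup h h' hβ ta.left
    have hCY : C.ncard < Y.ncard := hl.ncard_lt_inter_objNormalizer hp h ta.left hCsub
      Set.inter_subset_left (subset_kerHull hCS) (fun e => hs e.symm.subset)
    have hYp : P.IsPSubgroup p Y :=
      hl.inter_objNormalizer_isPSubgroup hp h ta.left hCsub Set.inter_subset_left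
    have hYΔ : Y ∈ Δ := hl.inter_objNormalizer_mem h ta.left hCsub Set.inter_subset_left
      (subset_kerHull hCS)
    have hYn : Y ⊆ objNormalizer P L₀ Δ C := Set.inter_subset_right
    obtain ⟨k, tk, hk, hkY⟩ := hl.exists_conj_ker hp h h' hβ ta.right hV
      (hl.conjSet_isPSubgroup h ta hYp hYn)
      (by rintro _ ⟨y, hy, rfl⟩; exact hl.conj_mem_objNormalizer h ta (hYn hy))
      (by
        rintro _ ⟨y, hy, rfl⟩
        obtain ⟨⟨-, c, hc, e⟩, hyn⟩ := hy
        have hcV := ta.conj_mem hc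
        refine ⟨P.conj c a, ⟨hl.subset ta.right hcV, hl.subset_objNormalizer h ta.right hcV⟩, ?_⟩
        show β _ = β (P.conj y a)
        rw [hβ.map_conj h h' (ta.sub hc), hβ.map_conj h h' (hl.mem_Dconj h ta hyn), e])
    have t2 := hl.conjugates_mul h ta tk
    have t3 := hl.conjugates_conjSet h t2 hYΔ hYn (by
      rintro _ ⟨y, hy, rfl⟩
      show P.conj y _ ∈ S
      rw [hl.conj_mul h ta tk (hYn hy)]
      exact hkY _ ⟨y, hy, rfl⟩)
    have hYle : Y.ncard ≤ S.ncard := Set.ncard_le_ncard hYS hSfin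
    obtain ⟨a', e, t4⟩ := ih (S.ncard - Y.ncard) (by omega) t3 rfl
    have hYC : β '' Y = β '' C := Set.Subset.antisymm
      ((Set.image_mono Set.inter_subset_left).trans (image_kerHull hCS).subset)
      (Set.image_mono (Set.subset_inter (subset_kerHull hCS)
        (hl.subset_objNormalizer h ta.left)))
    refine ⟨a', e.trans (hl.map_mul_ker h' hβ ta tk hk), ?_⟩
    rwa [kerHull_congr hYC, kerHull_congr (Y := V)
      ((t3.image_eq h h' hβ).trans ((congrArg (P'.conjSet · _) hYC).trans (t2.image_eq h h' hβ).symm))] at t4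
  obtain ⟨k, V, tk, hV, -⟩ := hl.exists_fully_normalized hp h t.right
  obtain ⟨a, ea, ta⟩ := key (hl.conjugates_mul h t tk) rfl hV
  obtain ⟨b, eb, tb⟩ := key tk (t.ncard_eq h).symm hV
  have tb' := tb.inv h hl.partialSubgroup
  refine ⟨_, ?_, hl.conjugates_mul h ta tb'⟩
  have tk' := tk.inv h hl.partialSubgroup
  rw [hβ.map_mul (hl.mul_mem_D ta tb'), hβ.map_inv h h', ea, eb, ← hβ.map_inv h h',
    ← hβ.map_mul (hl.mul_mem_D (hl.conjugates_mul h t tk) tk'), h.mul_mul_inv (hl.mul_mem_D t tk)]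

theorem subset_conjDom (h : IsPartialGroup P) (h' : IsPartialGroup P')
    (hβ : IsHom P P' β) (hl : IsLocalityIn p P L₀ Δ S) (t : Conjugates P L₀ Δ g A B) :
    A ⊆ conjDom P' β S (β g) := fun x hx =>
  ⟨hl.subset t.left hx, hβ.map_mem_Dconj h h' (t.sub hx), P.conj x g,
    hl.subset t.right (t.conj_mem hx), hβ.map_conj h h' (t.sub hx)⟩

theorem exists_conjugates_of_mem_conjDom (h : IsPartialGroup P) (h' : IsPartialGroup P')
    (hβ : IsHom P P' β) (hl : IsLocalityIn p P L₀ Δ S) (t : Conjugates P L₀ Δ g A B)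
    (hx : x ∈ conjDom P' β S (β g)) :
    ∃ a C, β a = β g ∧ Conjugates P L₀ Δ a (P.conjSet A x) C := by
  obtain ⟨hxS, hxD, s, hs, e⟩ := hx
  have tx := (hl.conjugates_of_mem h t.left hxS).inv h hl.partialSubgroup
  have ts := hl.conjugates_of_mem h t.right hs
  have t1 := hl.conjugates_mul h tx t
  refine ⟨_, _, ?_, hl.conjugates_mul h t1 ts⟩
  have hw := hβ.1 _ (hl.mem_D tx.left (tx.cons (t.cons (ts.cons Conjugates.nil))))
  simp only [List.map_cons, List.map_nil, hβ.map_inv h h', e] at hw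
  rw [hβ.map_mul (hl.mul_mem_D t1 ts), hβ.map_mul (hl.mul_mem_D tx t), hβ.map_inv h h', e]
  exact (h'.assoc_pi [] [P'.inv (β x), β g] _ hw).symm.trans (h'.inv_mul_mul_conj hxD)

theorem conjDom_isSubgroup (h : IsPartialGroup P) (h' : IsPartialGroup P')
    (hβ : IsHom P P' β) (hl : IsLocalityIn p P L₀ Δ S) (t : Conjugates P L₀ Δ g A B) :
    P.IsSubgroup (conjDom P' β S (β g)) := by
  have hS := hl.pSubgroup.1
  have hβS := hS.image h h' hβ
  refine Data.IsSubgroup.of_subset h hS (fun x hx => hx.1)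
    (hl.subset_conjDom h h' hβ t (hl.subgroup t.left).one_mem) ?_ ?_
  · rintro x ⟨hx, hxD, hxS⟩
    refine ⟨hS.inv_mem hx, ?_⟩
    rw [hβ.map_inv h h', h'.conj_inv hxD]
    exact ⟨h'.inv_mem_Dconj hxD, hβS.inv_mem hxS⟩
  · rintro x hx y hy
    obtain ⟨a, C, ea, ta⟩ := hl.exists_conjugates_of_mem_conjDom h h' hβ t hx
    obtain ⟨b, E, eb, tb⟩ := hl.exists_conjugates_of_mem_conjDom h h' hβ ta (ea.symm ▸ hy)
    have hw := hβ.1 _ (hl.mem_D t.right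
      ((t.inv h hl.partialSubgroup).cons <| (hl.conjugates_of_mem h t.left hx.1).cons <|
        ta.cons <| (ta.inv h hl.partialSubgroup).cons <|
        (hl.conjugates_of_mem h ta.left hy.1).cons <| tb.cons Conjugates.nil))
    simp only [List.map_cons, List.map_nil, hβ.map_inv h h', ea, eb] at hw
    refine ⟨hS.mul_mem hx.1 hy.1, ?_⟩
    rw [hβ.map_mul (hS.mem (by simp [hx.1, hy.1])), h'.conj_mul hw]
    exact ⟨h'.mul_mem_Dconj hw, hβS.mul_mem hx.2.2 hy.2.2⟩

/-- Every `f ∈ L₀β` lifts to an element of `L₀` conjugating the full preimage in `S` of the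
domain of conjugation by `f` on `Sβ` to an object. -/
theorem exists_conjugates_conjDom (hp : p.Prime) (h : IsPartialGroup P) (h' : IsPartialGroup P')
    (hβ : IsHom P P' β) (hl : IsLocalityIn p P L₀ Δ S) (hf : f ∈ L₀) :
    ∃ g Y, β g = β f ∧ Conjugates P L₀ Δ g (conjDom P' β S (β f)) Y := by
  have hSfin : S.Finite := hl.finite_sub Set.Subset.rfl
  obtain ⟨A₀, B₀, t₀⟩ := hl.exists_conjugates h hf
  obtain ⟨A, ⟨g, B, eg, t⟩, hmax⟩ := Set.exists_max_image
    {A | ∃ g B, β g = β f ∧ Conjugates P L₀ Δ g A B} Set.ncard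
    (hSfin.finite_subsets.subset fun A ⟨_, _, _, t⟩ => hl.subset t.left) ⟨A₀, f, B₀, rfl, t₀⟩
  have hmax' : ∀ {A' B' g'}, β g' = β f → Conjugates P L₀ Δ g' A' B' → A'.ncard ≤ A.ncard :=
    fun e' t' => hmax _ ⟨_, _, e', t'⟩
  rw [← eg]
  by_cases hne : A = conjDom P' β S (β g)
  · exact ⟨g, B, rfl, hne ▸ t⟩
  exfalso
  have hsatA : kerHull S β A ⊆ A := by
    obtain ⟨g', e', t'⟩ := hl.exists_conjugates_kerHull hp h h' hβ t
    exact (Set.eq_of_subset_of_ncard_le (subset_kerHull (hl.subset t.left))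
      (hmax' (e'.trans eg) t') (hl.finite_sub Set.inter_subset_left)).symm.subset
  have hsatB := hl.kerHull_subset_of_conjugates h h' hβ t hsatA
  set X := conjDom P' β S (β g)
  have hX : P.IsSubgroup X := hl.conjDom_isSubgroup h h' hβ t
  have hXS : X ⊆ S := fun x hx => hx.1
  have hAX : A ⊆ X := hl.subset_conjDom h h' hβ t
  have hAY := hl.ncard_lt_inter_objNormalizer hp h t.left hX hXS hAX hne
  have hYp := hl.inter_objNormalizer_isPSubgroup hp h t.left hX hXS
  have hYΔ := hl.inter_objNormalizer_mem h t.left hX hXS hAX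
  set Y := X ∩ objNormalizer P L₀ Δ A
  have hYn : Y ⊆ objNormalizer P L₀ Δ A := Set.inter_subset_right
  obtain ⟨c, V, tc, hV, hcS⟩ := hl.exists_fully_normalized hp h t.right
  have ta := hl.conjugates_mul h t tc
  have hlift : ∀ y ∈ Y, ∃ s ∈ S ∩ objNormalizer P L₀ Δ B,
      β (P.conj s c) = β (P.conj y (P.pi [g, c])) := by
    intro y hy
    obtain ⟨s, hs, e⟩ := hy.1.2.2
    rw [← hβ.map_conj h h' (hl.mem_Dconj h t (hYn hy))] at e
    have hyB := hl.conj_mem_objNormalizer h t (hYn hy)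
    have hsB := hl.mem_objNormalizer_of_map_eq h h' hβ hsatB hyB hs e
    refine ⟨s, ⟨hs, hsB⟩, ?_⟩
    rw [hl.conj_mul h t tc (hYn hy), hβ.map_conj h h' (hl.mem_Dconj h tc hsB), e,
      hβ.map_conj h h' (hl.mem_Dconj h tc hyB)]
  have hYan : P.conjSet Y (P.pi [g, c]) ⊆ objNormalizer P L₀ Δ V := by
    rintro _ ⟨y, hy, rfl⟩
    exact hl.conj_mem_objNormalizer h ta (hYn hy)
  obtain ⟨k, tk, hk, hkY⟩ := hl.exists_conj_ker hp h h' hβ ta.right hV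
    (hl.conjSet_isPSubgroup h ta hYp hYn) hYan (by
      rintro _ ⟨y, hy, rfl⟩
      obtain ⟨s, hs, e⟩ := hlift y hy
      exact ⟨_, ⟨hcS s hs, hl.conj_mem_objNormalizer h tc hs.2⟩, e⟩)
  have ta2 := hl.conjugates_mul h ta tk
  have hconj : ∀ y ∈ Y, P.conj y (P.pi [P.pi [g, c], k]) =
      P.conj (P.conj y (P.pi [g, c])) k := fun y hy => hl.conj_mul h ta tk (hYn hy)
  have t3 := hl.conjugates_conjSet h ta2 hYΔ hYn (by
    rintro _ ⟨y, hy, rfl⟩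
    show P.conj y _ ∈ S
    rw [hconj y hy]
    exact hkY _ ⟨y, hy, rfl⟩)
  have hMΔ := hl.inter_objNormalizer_mem h t.right hl.pSubgroup.1 Set.Subset.rfl
    (hl.subset t.right)
  have tM := hl.conjugates_conjSet h tc hMΔ Set.inter_subset_right (by
    rintro _ ⟨s, hs, rfl⟩
    exact hcS s hs)
  have hsatM : kerHull S β (S ∩ objNormalizer P L₀ Δ B) ⊆ S ∩ objNormalizer P L₀ Δ B := by
    rintro s ⟨hs, m, hm, e⟩
    exact ⟨hs, hl.mem_objNormalizer_of_map_eq h h' hβ hsatB hm.2 hs e.symm⟩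
  have hsatM' := hl.kerHull_subset_of_conjugates h h' hβ tM hsatM
  have t4 := hl.restrict h (tM.inv h hl.partialSubgroup) t3.right (by
    rintro _ ⟨y, hy, rfl⟩
    obtain ⟨s, hs, e⟩ := hlift y hy
    refine hsatM' ⟨hl.subset t3.right ⟨y, hy, rfl⟩, P.conj s c, ⟨s, hs, rfl⟩, ?_⟩
    show _ = β (P.conj y _)
    rw [hconj y hy, hβ.map_conj h h' (hl.mem_Dconj h tk (hYan ⟨y, hy, rfl⟩)), hk, h'.conj_one, e])
  refine hAY.not_ge (hmax' ?_ (hl.conjugates_mul h t3 t4))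
  rw [hβ.map_mul (hl.mul_mem_D t3 t4), hl.map_mul_ker h' hβ ta tk hk,
    ← hβ.map_mul (hl.mul_mem_D ta (tc.inv h hl.partialSubgroup)),
    h.mul_mul_inv (hl.mul_mem_D t tc), eg]

end IsLocalityIn

theorem chainFrom_map (h : IsPartialGroup P) (h' : IsPartialGroup P') (hβ : IsHom P P' β)
    (hw : chainFrom P Δ w A) : chainFrom P' (Set.image β '' Δ) (w.map β) (β '' A) := by
  induction w generalizing A with
  | nil => trivial
  | cons g w ih =>
    obtain ⟨hA, hB, hw⟩ := hw
    have e := hβ.image_conjSet h h' hA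
    refine ⟨?_, e ▸ ⟨_, hB, rfl⟩, e ▸ ih hw⟩
    rintro _ ⟨x, hx, rfl⟩
    exact hβ.map_mem_Dconj h h' (hA hx)

namespace IsLocalityIn

theorem exists_conjugates_of_subset_conjDom (hp : p.Prime) (h : IsPartialGroup P)
    (h' : IsPartialGroup P') (hβ : IsHom P P' β) (hl : IsLocalityIn p P L₀ Δ S) (hf : f ∈ L₀)
    (hA : A ∈ Δ) (hAf : A ⊆ conjDom P' β S (β f)) :
    ∃ g, β g = β f ∧ Conjugates P L₀ Δ g A (P.conjSet A g) := by
  obtain ⟨g, Y, e, t⟩ := hl.exists_conjugates_conjDom hp h h' hβ hf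
  exact ⟨g, e, hl.restrict h t hA hAf⟩

theorem eq_image_of_isPSubgroup (hp : p.Prime) (h : IsPartialGroup P)
    (h' : IsPartialGroup P') (hβ : IsHom P P' β) (hl : IsLocalityIn p P L₀ Δ S) {T : Set L'}
    (hTL : T ⊆ β '' L₀) (hT : P'.IsPSubgroup p T) (hST : β '' S ⊆ T) : T = β '' S := by
  by_contra hne
  have hS := hl.pSubgroup.1
  obtain ⟨f', hf', hfS, hn⟩ := hT.exists_normalizing hp h' (hS.image h h' hβ) hST
    (fun e => hne e.symm)
  obtain ⟨f, hf, rfl⟩ := hTL hf'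
  obtain ⟨g, e, t⟩ := hl.exists_conjugates_of_subset_conjDom hp h h' hβ hf (hl.s_mem h)
    fun s hs => ⟨hs, hT.1.mem_Dconj (hST ⟨s, hs, rfl⟩) hf', hn _ ⟨s, hs, rfl⟩⟩
  rw [Set.eq_of_subset_of_ncard_le (hl.subset t.right) (t.ncard_eq h).le
    (hl.finite_sub Set.Subset.rfl)] at t
  have hH := (hl.objNormalizer_isSubgroup h (hl.s_mem h)).inter_preimage h h' hβ hT.1
  have hmax : P.IsMaxPSubgroupIn p S (objNormalizer P L₀ Δ S ∩ β ⁻¹' T) :=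
    ⟨hl.pSubgroup, fun s hs => ⟨hl.subset_objNormalizer h (hl.s_mem h) hs, hST ⟨s, hs, rfl⟩⟩,
      fun Y hY hSY hYH => hl.s_maximal Y
        (hYH.trans (Set.inter_subset_left.trans objNormalizer_subset)) hY hSY⟩
  have hHp := hT.of_subset hp h' (hH.image h h' hβ)
    (Set.image_subset_iff.2 Set.inter_subset_right)
  have himg := hmax.image_eq hp h h' hβ hH
    (hl.finite.subset (Set.inter_subset_left.trans objNormalizer_subset)) hHp
  refine hfS (himg.subset ⟨g, ⟨t, ?_⟩, e⟩)
  rwa [Set.mem_preimage, e]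

theorem exists_actsOn_of_chainFrom_image (hp : p.Prime) (h : IsPartialGroup P)
    (h' : IsPartialGroup P') (hβ : IsHom P P' β) (hl : IsLocalityIn p P L₀ Δ S) {w : List L'}
    (hwL : w ∈ Wrd (β '' L₀)) (hA : A ∈ Δ) (hw : chainFrom P' (Set.image β '' Δ) w (β '' A)) :
    ∃ v, v.map β = w ∧ ActsOn P L₀ Δ v (kerHull S β A) := by
  induction w generalizing A with
  | nil => exact ⟨[], rfl, Conjugates.nil⟩
  | cons f' w ih =>
    obtain ⟨⟨f, hf, rfl⟩, hwL'⟩ := List.forall_mem_cons.1 hwL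
    obtain ⟨hAf, ⟨B, hB, eB : β '' B = _⟩, hw⟩ := hw
    rw [← eB] at hw
    have hAS := hl.subset hA
    obtain ⟨g, e, t⟩ := hl.exists_conjugates_of_subset_conjDom hp h h' hβ hf
      (hl.kerHull_mem h h' hβ hA) (by
        rintro s ⟨hs, hsA⟩
        exact ⟨hs, hAf hsA, Set.image_mono (hl.subset hB) (eB.symm.subset ⟨_, hsA, rfl⟩)⟩)
    have himg := t.image_eq h h' hβ
    rw [image_kerHull hAS, e, ← eB] at himg
    have hsat := hl.kerHull_subset_of_conjugates h h' hβ t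
      (kerHull_congr (image_kerHull hAS)).subset
    obtain ⟨v, rfl, hv⟩ := ih hwL' hB hw
    refine ⟨g :: v, by rw [List.map_cons, e], t.cons ?_⟩
    rwa [(subset_kerHull (hl.subset t.right)).antisymm hsat, kerHull_congr himg]

theorem image (hp : p.Prime) (h : IsPartialGroup P) (h' : IsPartialGroup P')
    (hβ : IsHom P P' β) (hl : IsLocalityIn p P L₀ Δ S)
    (hD : List.map β '' (P.D ∩ Wrd L₀) = P'.D ∩ Wrd (β '' L₀)) :
    IsLocalityIn p P' (β '' L₀) (Set.image β '' Δ) (β '' S) where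
  partialSubgroup := by
    refine ⟨?_, fun w hw => ?_⟩
    · rintro _ ⟨f, hf, rfl⟩
      exact ⟨_, hl.partialSubgroup.1 f hf, hβ.map_inv h h' f⟩
    · obtain ⟨v, hv, rfl⟩ := hD.ge ⟨hw.2, hw.1⟩
      exact ⟨_, hl.partialSubgroup.2 v ⟨hv.2, hv.1⟩, (hβ.2 v hv.1).symm⟩
  finite := hl.finite.image β
  pSubgroup := hl.pSubgroup.image hp h h' hβ
  s_sub := Set.image_mono hl.s_sub
  delta_nonempty := hl.delta_nonempty.image _
  delta_subgroups := by
    rintro _ ⟨A, hA, rfl⟩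
    exact ⟨(hl.subgroup hA).image h h' hβ, Set.image_mono (hl.subset hA)⟩
  s_maximal T hTL hT hST := hl.eq_image_of_isPSubgroup hp h h' hβ hTL hT hST
  d_eq w hwL := by
    constructor
    · intro hw
      obtain ⟨v, hv, rfl⟩ := hD.ge ⟨hw, hwL⟩
      obtain ⟨A, hA, hvA⟩ := (hl.d_eq v hv.2).1 hv.1
      exact ⟨_, ⟨A, hA, rfl⟩, chainFrom_map h h' hβ hvA⟩
    · rintro ⟨_, ⟨A, hA, rfl⟩, hw⟩
      obtain ⟨v, rfl, hv⟩ := hl.exists_actsOn_of_chainFrom_image hp h h' hβ hwL hA hw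
      exact hβ.1 v (hl.mem_D (hl.kerHull_mem h h' hβ hA) hv)
  delta_closed := by
    rintro Q hQ hQS ⟨_, ⟨A, hA, rfl⟩, _, ⟨f, hf, rfl⟩, hAf, hAQ⟩
    obtain ⟨g, e, t⟩ := hl.exists_conjugates_of_subset_conjDom hp h h' hβ hf hA fun x hx =>
      ⟨hl.subset hA hx, hAf ⟨x, hx, rfl⟩, hQS (hAQ ⟨_, ⟨x, hx, rfl⟩, rfl⟩)⟩
    refine ⟨S ∩ β ⁻¹' Q, hl.delta_closed _ (hl.pSubgroup.1.inter_preimage h h' hβ hQ)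
      Set.inter_subset_left ⟨A, hA, g, t.mem, t.sub, ?_⟩, ?_⟩
    · refine Set.subset_inter (hl.subset t.right) (Set.image_subset_iff.1 ?_)
      rwa [t.image_eq h h' hβ, e]
    · show β '' _ = Q
      rw [Set.image_inter_preimage, Set.inter_eq_right]
      exact hQS

end IsLocalityIn

end Localities

/-- Lemma 3.13: let `(L,Δ,S)` and `(L',Δ',S')` be localities, `β : L → L'` a
homomorphism of partial groups, and `(L₀,Δ₀,S₀)` a sublocality of `(L,Δ,S)` with
`S₀β ⊆ S'` and `(D ∩ W(L₀))β* = D' ∩ W(L₀β)`.  Then `(L₀β,Δ₀β,S₀β)` is a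
sublocality of `(L',Δ',S')` and `β|_{L₀} : L₀ → L₀β` is a projection of localities
from `(L₀,Δ₀,S₀)` to `(L₀β,Δ₀β,S₀β)`. -/
theorem sublocality_image (p : ℕ) (hp : p.Prime)
    (P : Data L) (Δ : Set (Set L)) (S : Set L)
    (P' : Data L') (Δ' : Set (Set L')) (S' : Set L')
    (hloc : IsLocality p P Δ S) (hloc' : IsLocality p P' Δ' S')
    (β : L → L') (hβ : IsHom P P' β)
    (L₀ : Set L) (Δ₀ : Set (Set L)) (S₀ : Set L)
    (hsub : IsSubLocality p P S L₀ Δ₀ S₀)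
    (hS₀ : β '' S₀ ⊆ S')
    (hD : List.map β '' (P.D ∩ Wrd L₀) = P'.D ∩ Wrd (β '' L₀)) :
    IsSubLocality p P' S' (β '' L₀) (Set.image β '' Δ₀) (β '' S₀) ∧
    IsLocalityProjBetween P P' L₀ Δ₀ (β '' L₀) (Set.image β '' Δ₀) β := by
  have h := hloc.isPartialGroup
  have h' := hloc'.isPartialGroup
  have hl := hsub.2
  have himg := hl.image hp h h' hβ hD
  refine ⟨⟨?_, himg⟩, ⟨rfl, ⟨fun w hw => hβ.1 w hw.1, fun w hw => hβ.2 w hw.1⟩,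
    fun w hw => hD.ge hw⟩, rfl⟩
  exact (himg.s_maximal _ Set.inter_subset_right (hloc'.pSubgroup.of_subset hp h'
    (hloc'.pSubgroup.1.inter himg.partialSubgroup) Set.inter_subset_left)
    (Set.subset_inter hS₀ himg.s_sub)).symm

end PartialGroups
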